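/- Let K ⊂ ℝ^{n+1} be a smooth, strictly convex body whose support function h satisfies the self-similarity equation 𝒦 = h on S^n (Gauss curvature equals support function under the Gauss map parametrization). Then K is the closed unit ball centred at the origin. -/

import Mathlib

open MeasureTheory Metric
open scoped RealInnerProductSpace ENNReal

noncomputable section

abbrev E (n : ℕ) : Type := EuclideanSpace ℝ (Fin (n + 1))

/-- The Hessian of `H` as a continuous linear map. -/
def hess {n : ℕ} (H : E n → ℝ) (x : E n) : E n →L[ℝ] E n :=
  fderiv ℝ (gradient H) x

/-- The rank-one projection `y ↦ ⟪x, y⟫ • x`. -/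
def proj {n : ℕ} (x : E n) : E n →L[ℝ] E n :=
  ((innerSL ℝ) x).smulRight x

/-- `σ_n = det(∇̄²h + h ḡ)/det ḡ = 1/𝒦`, computed as the determinant of
`D²H + x ⊗ x` where `H` is the 1-homogeneous extension of the support function. -/
def sigmaDet {n : ℕ} (H : E n → ℝ) (x : E n) : ℝ :=
  LinearMap.det ((hess H x + proj x) : E n →L[ℝ] E n).toLinearMap

/-- Tangential (spherical) gradient of the restriction to the unit sphere. -/
def tgrad {n : ℕ} (F : E n → ℝ) (x : E n) : E n :=
  gradient F x - ⟪gradient F x, x⟫ • x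

/-- The convex body with support function `H`. -/
def body {n : ℕ} (H : E n → ℝ) : Set (E n) :=
  {y | ∀ x ∈ sphere (0 : E n) 1, ⟪y, x⟫ ≤ H x}

/-- One-dimensional Brunn–Minkowski inequality for midpoints. -/
theorem volume_add_volume_le_of_midpoint {A B C : Set ℝ} (hA : MeasurableSet A)
    (hB : MeasurableSet B) (hA0 : A.Nonempty) (hB0 : B.Nonempty)
    (hC : ∀ a ∈ A, ∀ b ∈ B, (a + b) / 2 ∈ C) :
    volume A + volume B ≤ 2 * volume C := by
  have key : ∀ K ⊆ A, ∀ L ⊆ B, IsCompact K → IsCompact L → K.Nonempty → L.Nonempty →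
      volume K + volume L ≤ 2 * volume C := by
    intro K hKA L hLB hK hL hK0 hL0
    obtain ⟨k, hk, hkmax⟩ := hK.exists_isGreatest hK0
    obtain ⟨l, hl, hlmin⟩ := hL.exists_isLeast hL0
    set K' : Set ℝ := (fun x => (2 : ℝ) * x) ⁻¹' ((fun x => x + -l) ⁻¹' K) with hK'
    set L' : Set ℝ := (fun x => (2 : ℝ) * x) ⁻¹' ((fun x => x + -k) ⁻¹' L) with hL'
    have vol : ∀ (S : Set ℝ) (c : ℝ),
        volume ((fun x => (2 : ℝ) * x) ⁻¹' ((fun x => x + -c) ⁻¹' S)) = 2⁻¹ * volume S := by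
      intro S c
      rw [Real.volume_preimage_mul_left two_ne_zero, measure_preimage_add_right]
      norm_num [ENNReal.ofReal_div_of_pos]
    have hsub : K' ∪ L' ⊆ C := by
      rintro x (hx | hx)
      · have := hC _ (hKA hx) _ (hLB hl)
        convert this using 1; ring
      · have := hC _ (hKA hk) _ (hLB hx)
        convert this using 1; ring
    have hinter : K' ∩ L' ⊆ {(k + l) / 2} := by
      rintro x ⟨h1, h2⟩
      have h1 := hkmax h1
      have h2 := hlmin h2
      simp only [Set.mem_singleton_iff]
      linarith
    have hLm : MeasurableSet L' := by
      have := hL.measurableSet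
      measurability
    have h := measure_union_add_inter (μ := volume) K' hLm
    rw [measure_mono_null hinter (by simp), add_zero, hK', hL', vol, vol, ← mul_add] at h
    calc volume K + volume L = 2 * (2⁻¹ * (volume K + volume L)) := by
          rw [← mul_assoc, ENNReal.mul_inv_cancel (by simp) (by simp), one_mul]
      _ ≤ 2 * volume C := by
          rw [← h]; gcongr
  obtain ⟨a, ha⟩ := hA0
  obtain ⟨b, hb⟩ := hB0
  rw [hA.measure_eq_iSup_isCompact, hB.measure_eq_iSup_isCompact]
  simp only [iSup_and']
  refine ENNReal.biSup_add_biSup_le' ⟨∅, by simp⟩ ⟨∅, by simp⟩ fun K hK L hL => ?_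
  calc volume K + volume L ≤ volume (insert a K) + volume (insert b L) := by
        gcongr <;> exact Set.subset_insert _ _
    _ ≤ _ := key _ (Set.insert_subset ha hK.1) _ (Set.insert_subset hb hL.1)
        (hK.2.insert a) (hL.2.insert b) (Set.insert_nonempty _ _) (Set.insert_nonempty _ _)

/-- One-dimensional Prékopa–Leindler inequality for midpoints, normalised functions. -/
theorem lintegral_add_lintegral_le_of_iSup_eq_one {f g h : ℝ → ℝ≥0∞} (hf : Measurable f)
    (hg : Measurable g) (hh : Measurable h) (hf1 : ⨆ x, f x = 1) (hg1 : ⨆ x, g x = 1)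
    (hfg : ∀ x y, f x * g y ≤ h ((x + y) / 2) ^ 2) :
    (∫⁻ x, f x) + ∫⁻ x, g x ≤ 2 * ∫⁻ x, h x := by
  have layer : ∀ u : ℝ → ℝ≥0∞, Measurable u → (∀ x, u x ≤ 1) →
      ∫⁻ x, u x = ∫⁻ t in Set.Ioo (0 : ℝ) 1, volume {x | ENNReal.ofReal t < u x} := by
    intro u hu hu1
    have hfin : ∀ x, u x ≠ ∞ := fun x => ((hu1 x).trans_lt ENNReal.one_lt_top).ne
    have h1 : ∫⁻ x, u x = ∫⁻ x, ENNReal.ofReal (u x).toReal := by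
      simp_rw [ENNReal.ofReal_toReal (hfin _)]
    rw [h1, lintegral_eq_lintegral_meas_lt _ (Filter.Eventually.of_forall fun _ => by positivity)
      hu.ennreal_toReal.aemeasurable,
      ← lintegral_add_compl (μ := volume.restrict (Set.Ioi (0 : ℝ))) _
        (measurableSet_Iio (a := (1 : ℝ)))]
    rw [Measure.restrict_restrict measurableSet_Iio,
      Measure.restrict_restrict measurableSet_Iio.compl]
    have h2 : ∫⁻ t in (Set.Iio (1 : ℝ))ᶜ ∩ Set.Ioi 0, volume {x | t < (u x).toReal} = 0 := by
      rw [setLIntegral_congr_fun (g := fun _ => 0)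
        (measurableSet_Iio.compl.inter measurableSet_Ioi)]
      · simp
      · intro t ht
        have : {x | t < (u x).toReal} = ∅ := by
          ext x
          have h3 := ENNReal.toReal_mono ENNReal.one_ne_top (hu1 x)
          have h4 : (1 : ℝ) ≤ t := by simpa using ht.1
          simp only [ENNReal.toReal_one] at h3
          simp only [Set.mem_ofPred_eq, Set.mem_empty_iff_false, iff_false, not_lt]
          linarith
        simp [this]
    rw [h2, add_zero, Set.inter_comm, Set.Ioi_inter_Iio]
    refine setLIntegral_congr_fun measurableSet_Ioo fun t ht => ?_
    congr 1
    ext x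
    exact (ENNReal.ofReal_lt_iff_lt_toReal ht.1.le (hfin x)).symm
  have hle : ∀ (u : ℝ → ℝ≥0∞), ⨆ x, u x = 1 → ∀ x, u x ≤ 1 := fun u hu x => hu ▸ le_iSup u x
  have meas : ∀ u : ℝ → ℝ≥0∞, Measurable fun t : ℝ => volume {x | ENNReal.ofReal t < u x} := by
    intro u
    refine Antitone.measurable fun s t hst => measure_mono fun x hx => ?_
    exact (ENNReal.ofReal_le_ofReal hst).trans_lt hx
  have hmin : ∫⁻ x, min (h x) 1 ≤ ∫⁻ x, h x := lintegral_mono fun x => min_le_left _ _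
  refine le_trans ?_ (mul_le_mul_right hmin 2)
  rw [layer f hf (hle f hf1), layer g hg (hle g hg1),
    layer _ (hh.min measurable_const) fun x => min_le_right _ _,
    ← lintegral_add_left (meas f), ← lintegral_const_mul _ (meas _)]
  refine setLIntegral_mono ((meas _).const_mul _) fun t ht => ?_
  have ht1 : ENNReal.ofReal t < 1 := by simpa using ht.2
  have ne : ∀ u : ℝ → ℝ≥0∞, ⨆ x, u x = 1 → {x | ENNReal.ofReal t < u x}.Nonempty :=
    fun u hu => lt_iSup_iff.1 (show _ < ⨆ x, u x from hu ▸ ht1)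
  refine volume_add_volume_le_of_midpoint (measurableSet_lt measurable_const hf)
    (measurableSet_lt measurable_const hg) (ne f hf1) (ne g hg1) fun a ha b hb => ?_
  refine lt_min ?_ ht1
  have h5 : ENNReal.ofReal t * ENNReal.ofReal t < f a * g b := ENNReal.mul_lt_mul ha hb
  have h6 := h5.trans_le (hfg a b)
  rw [← sq] at h6
  by_contra! h7
  exact absurd h6 (not_lt.2 (pow_le_pow_left' h7 2))

theorem mul_le_sq_of_add_le {a b c : ℝ≥0∞} (h : a + b ≤ 2 * c) : a * b ≤ c ^ 2 := by
  rcases eq_or_ne c ∞ with rfl | hc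
  · simp
  have hab : a + b ≠ ∞ := (h.trans_lt (ENNReal.mul_lt_top (by simp) hc.lt_top)).ne
  obtain ⟨ha, hb⟩ := ENNReal.add_ne_top.1 hab
  lift a to NNReal using ha
  lift b to NNReal using hb
  lift c to NNReal using hc
  norm_cast at h ⊢
  rw [← NNReal.coe_le_coe] at h ⊢
  push_cast at h ⊢
  nlinarith [sq_nonneg ((a : ℝ) - b), a.coe_nonneg, b.coe_nonneg]

/-- One-dimensional Prékopa–Leindler inequality for midpoints. -/
theorem prekopaLeindler_real {f g h : ℝ → ℝ≥0∞} (hf : Measurable f)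
    (hg : Measurable g) (hh : Measurable h) (hfg : ∀ x y, f x * g y ≤ h ((x + y) / 2) ^ 2) :
    (∫⁻ x, f x) * ∫⁻ x, g x ≤ (∫⁻ x, h x) ^ 2 := by
  have bdd : ∀ f g : ℝ → ℝ≥0∞, Measurable f → Measurable g →
      (∀ x y, f x * g y ≤ h ((x + y) / 2) ^ 2) → ⨆ x, f x ≠ ∞ → ⨆ x, g x ≠ ∞ →
      (∫⁻ x, f x) * ∫⁻ x, g x ≤ (∫⁻ x, h x) ^ 2 := by
    intro f g hf hg hfg hM hm
    rcases eq_or_ne (⨆ x, f x) 0 with hM0 | hM0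
    · simp [ENNReal.iSup_eq_zero.1 hM0]
    rcases eq_or_ne (⨆ x, g x) 0 with hm0 | hm0
    · simp [ENNReal.iSup_eq_zero.1 hm0]
    set M := ⨆ x, f x with hMdef
    set m := ⨆ x, g x with hmdef
    obtain ⟨c, hc⟩ : ∃ c : ℝ≥0∞, c ^ 2 = M * m := by
      refine ⟨(M * m) ^ (1 / 2 : ℝ), ?_⟩
      rw [← ENNReal.rpow_natCast, ← ENNReal.rpow_mul]
      norm_num
    have hc0 : c ≠ 0 := by
      rintro rfl
      simp [hM0, hm0, eq_comm] at hc
    have hct : c ≠ ∞ := by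
      rintro rfl
      simp [ENNReal.mul_eq_top, hM, hm, eq_comm] at hc
    have key := lintegral_add_lintegral_le_of_iSup_eq_one (f := fun x => M⁻¹ * f x)
      (g := fun x => m⁻¹ * g x) (h := fun x => c⁻¹ * h x) (hf.const_mul _) (hg.const_mul _)
      (hh.const_mul _) (by rw [← ENNReal.mul_iSup, ENNReal.inv_mul_cancel hM0 hM])
      (by rw [← ENNReal.mul_iSup, ENNReal.inv_mul_cancel hm0 hm]) (by
        intro x y
        rw [mul_mul_mul_comm, mul_pow, ← ENNReal.inv_pow, hc,
          ENNReal.mul_inv (Or.inl hM0) (Or.inl hM)]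
        gcongr
        exact hfg x y)
    rw [lintegral_const_mul _ hf, lintegral_const_mul _ hg, lintegral_const_mul _ hh] at key
    have key := mul_le_sq_of_add_le key
    rw [mul_mul_mul_comm, mul_pow, ← ENNReal.inv_pow, hc,
      ← ENNReal.mul_inv (Or.inl hM0) (Or.inl hM)]
      at key
    have hne : M * m ≠ 0 := mul_ne_zero hM0 hm0
    have hnt : M * m ≠ ∞ := ENNReal.mul_ne_top hM hm
    exact (ENNReal.mul_le_mul_iff_right (ENNReal.inv_ne_zero.2 hnt)
      (ENNReal.inv_ne_top.2 hne)).1 key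
  have trunc : ∀ u : ℝ → ℝ≥0∞, Measurable u →
      ∫⁻ x, u x = ⨆ k : ℕ, ∫⁻ x, min (u x) k := by
    intro u hu
    rw [← lintegral_iSup (fun k => hu.min measurable_const)]
    · congr 1 with x
      rw [← inf_iSup_eq]
      simp [ENNReal.iSup_natCast]
    · intro i j hij x
      simp only
      gcongr
  rw [trunc f hf, trunc g hg, ENNReal.iSup_mul]
  simp_rw [ENNReal.mul_iSup]
  refine iSup_le fun i => iSup_le fun j => bdd _ _ (hf.min measurable_const)
    (hg.min measurable_const) (fun x y => ?_) ?_ ?_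
  · exact le_trans (mul_le_mul' (min_le_left _ _) (min_le_left _ _)) (hfg x y)
  · exact ((iSup_le fun x => min_le_right _ _).trans_lt (ENNReal.natCast_lt_top i)).ne
  · exact ((iSup_le fun x => min_le_right _ _).trans_lt (ENNReal.natCast_lt_top j)).ne

/-- Prékopa–Leindler inequality for midpoints in `Fin n → ℝ`. -/
theorem prekopaLeindler_pi (n : ℕ) {f g h : (Fin n → ℝ) → ℝ≥0∞} (hf : Measurable f)
    (hg : Measurable g) (hh : Measurable h)
    (hfg : ∀ x y, f x * g y ≤ h (fun i => (x i + y i) / 2) ^ 2) :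
    (∫⁻ x, f x) * ∫⁻ x, g x ≤ (∫⁻ x, h x) ^ 2 := by
  induction n with
  | zero =>
    have : ∀ u : (Fin 0 → ℝ) → ℝ≥0∞, ∫⁻ x, u x = u default := by
      intro u
      rw [volume_pi, Measure.pi_of_empty _ default, lintegral_dirac]
    rw [this, this, this]
    convert hfg default default using 3
  | succ n ih =>
    set Φ := (MeasurableEquiv.piFinSuccAbove (fun _ : Fin (n + 1) => ℝ) 0).symm with hΦ
    have e : MeasurePreserving Φ := (volume_preserving_piFinSuccAbove _ 0).symm
    have fub : ∀ u : (Fin (n + 1) → ℝ) → ℝ≥0∞, Measurable u →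
        ∫⁻ x, u x = ∫⁻ a : ℝ, ∫⁻ b : Fin n → ℝ, u (Φ (a, b)) := by
      intro u hu
      rw [← e.lintegral_comp hu, Measure.volume_eq_prod, lintegral_prod]
      exact (hu.comp e.measurable).aemeasurable
    have mc : ∀ u : (Fin (n + 1) → ℝ) → ℝ≥0∞, Measurable u →
        Measurable fun p : ℝ × (Fin n → ℝ) => u (Φ p) :=
      fun u hu => hu.comp e.measurable
    rw [fub f hf, fub g hg, fub h hh]
    refine prekopaLeindler_real (mc f hf).lintegral_prod_right' (mc g hg).lintegral_prod_right'
      (mc h hh).lintegral_prod_right' fun a b => ?_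
    refine ih ((mc f hf).comp measurable_prodMk_left) ((mc g hg).comp measurable_prodMk_left)
      ((mc h hh).comp measurable_prodMk_left) fun x y => ?_
    convert hfg (Φ (a, x)) (Φ (b, y)) using 3
    ext i
    refine Fin.cases ?_ (fun j => ?_) i <;> simp [hΦ]

/-- Multiplicative Brunn–Minkowski inequality for midpoints. -/
theorem brunnMinkowski_midpoint {n : ℕ} {A B C : Set (EuclideanSpace ℝ (Fin n))}
    (hA : MeasurableSet A) (hB : MeasurableSet B) (hC : MeasurableSet C)
    (hABC : ∀ a ∈ A, ∀ b ∈ B, (2⁻¹ : ℝ) • (a + b) ∈ C) :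
    volume A * volume B ≤ volume C ^ 2 := by
  have e := (EuclideanSpace.volume_preserving_symm_measurableEquiv_toLp (Fin n)).symm
  have vol : ∀ S : Set (EuclideanSpace ℝ (Fin n)), MeasurableSet S →
      volume S = ∫⁻ x : Fin n → ℝ, S.indicator 1 (WithLp.toLp 2 x) := by
    intro S hS
    rw [← lintegral_indicator_one hS, ← e.lintegral_comp (measurable_one.indicator hS)]
    rfl
  rw [vol A hA, vol B hB, vol C hC]
  refine prekopaLeindler_pi n ((measurable_one.indicator hA).comp e.measurable)
    ((measurable_one.indicator hB).comp e.measurable)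
    ((measurable_one.indicator hC).comp e.measurable) fun x y => ?_
  by_cases hx : WithLp.toLp 2 x ∈ A
  · by_cases hy : WithLp.toLp 2 y ∈ B
    · have h := hABC _ hx _ hy
      have : (2⁻¹ : ℝ) • (WithLp.toLp 2 x + WithLp.toLp 2 y) =
          WithLp.toLp 2 (fun i => (x i + y i) / 2) := by
        ext i
        simp; ring
      rw [this] at h
      simp [hx, hy, h]
    · simp [hy]
  · simp [hx]

section Calculus

variable {n : ℕ} {H : E n → ℝ}

theorem hasGradientAt_of_contDiffOn (hs : ContDiffOn ℝ (⊤ : ℕ∞) H {(0 : E n)}ᶜ) {x : E n}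
    (hx : x ≠ 0) : HasGradientAt H (gradient H x) x :=
  ((hs.contDiffAt (isOpen_compl_singleton.mem_nhds hx)).differentiableAt
    (by simp)).hasGradientAt

theorem contDiffOn_gradient (hs : ContDiffOn ℝ (⊤ : ℕ∞) H {(0 : E n)}ᶜ) :
    ContDiffOn ℝ (⊤ : ℕ∞) (gradient H) {(0 : E n)}ᶜ := by
  have h := hs.fderiv_of_isOpen (m := (⊤ : ℕ∞)) isOpen_compl_singleton (by simp)
  exact (InnerProductSpace.toDual ℝ (E n)).symm.contDiff.comp_contDiffOn h

theorem hasFDerivAt_gradient (hs : ContDiffOn ℝ (⊤ : ℕ∞) H {(0 : E n)}ᶜ) {x : E n}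
    (hx : x ≠ 0) : HasFDerivAt (gradient H) (hess H x) x :=
  (((contDiffOn_gradient hs).contDiffAt (isOpen_compl_singleton.mem_nhds hx)).differentiableAt
    (by simp)).hasFDerivAt

theorem contDiffOn_hess (hs : ContDiffOn ℝ (⊤ : ℕ∞) H {(0 : E n)}ᶜ) :
    ContDiffOn ℝ (⊤ : ℕ∞) (hess H) {(0 : E n)}ᶜ :=
  (contDiffOn_gradient hs).fderiv_of_isOpen (m := (⊤ : ℕ∞)) isOpen_compl_singleton (by simp)

theorem inner_hess_comm (hs : ContDiffOn ℝ (⊤ : ℕ∞) H {(0 : E n)}ᶜ) {x : E n}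
    (hx : x ≠ 0) (v w : E n) : ⟪hess H x v, w⟫ = ⟪v, hess H x w⟫ := by
  have key : ∀ v w : E n, fderiv ℝ (fderiv ℝ H) x v w = ⟪hess H x v, w⟫ := by
    intro v w
    have h1 : fderiv ℝ H = fun y => InnerProductSpace.toDual ℝ (E n) (gradient H y) := by
      ext1 y; simp [gradient]
    have h2 := ((InnerProductSpace.toDual ℝ (E n)).toContinuousLinearEquiv.toContinuousLinearMap
      |>.hasFDerivAt (x := gradient H x)).comp x (hasFDerivAt_gradient hs hx)
    rw [show fderiv ℝ H = _ from h1]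
    erw [h2.fderiv]
    simp
  have h := (hs.contDiffAt (isOpen_compl_singleton.mem_nhds hx)).isSymmSndFDerivAt
    (by simpa using! WithTop.coe_le_coe.2 (le_top (a := (2 : ℕ∞)))) v w
  rw [key, key] at h
  rw [h, real_inner_comm]

theorem gradient_smul_of_pos (hh : ∀ (t : ℝ) (x : E n), 0 < t → H (t • x) = t * H x)
    (hs : ContDiffOn ℝ (⊤ : ℕ∞) H {(0 : E n)}ᶜ) {t : ℝ} (ht : 0 < t) {x : E n} (hx : x ≠ 0) :
    gradient H (t • x) = gradient H x := by
  have hx' : t • x ≠ 0 := smul_ne_zero ht.ne' hx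
  have h1 : HasFDerivAt (fun y => H (t • y))
      (((InnerProductSpace.toDual ℝ (E n)) (gradient H (t • x))).comp
        (t • ContinuousLinearMap.id ℝ (E n))) x :=
    (hasGradientAt_of_contDiffOn hs hx').hasFDerivAt.comp x ((hasFDerivAt_id x).const_smul t)
  have h2 : HasFDerivAt (fun y => H (t • y))
      (t • (InnerProductSpace.toDual ℝ (E n)) (gradient H x)) x := by
    simp_rw [hh t _ ht]
    exact (hasGradientAt_of_contDiffOn hs hx).hasFDerivAt.const_mul t
  refine ext_inner_right ℝ fun v => ?_
  have h3 := congrArg (fun L : E n →L[ℝ] ℝ => L v) (h1.unique h2)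
  simp at h3
  simpa using h3.resolve_right ht.ne'

theorem inner_gradient_self (hh : ∀ (t : ℝ) (x : E n), 0 < t → H (t • x) = t * H x)
    (hs : ContDiffOn ℝ (⊤ : ℕ∞) H {(0 : E n)}ᶜ) {x : E n} (hx : x ≠ 0) :
    ⟪gradient H x, x⟫ = H x := by
  have h0 : HasDerivAt (fun t : ℝ => t • x) x 1 := by
    simpa using (hasDerivAt_id (1 : ℝ)).smul_const x
  have h1 : HasDerivAt (fun t : ℝ => H (t • x)) ⟪gradient H x, x⟫ 1 := by
    have := (hasGradientAt_of_contDiffOn hs hx).hasFDerivAt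
    rw [← one_smul ℝ x] at this
    simpa [Function.comp_def] using this.comp_hasDerivAt (1 : ℝ) h0
  have h2 : HasDerivAt (fun t : ℝ => H (t • x)) (H x) 1 := by
    have h3 : HasDerivAt (fun t : ℝ => t * H x) (H x) 1 := by
      simpa using (hasDerivAt_id (1 : ℝ)).mul_const (H x)
    refine h3.congr_of_eventuallyEq ?_
    filter_upwards [lt_mem_nhds (zero_lt_one (α := ℝ))] with t ht using hh t x ht
  exact h1.unique h2

theorem hess_smul_of_pos (hh : ∀ (t : ℝ) (x : E n), 0 < t → H (t • x) = t * H x)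
    (hs : ContDiffOn ℝ (⊤ : ℕ∞) H {(0 : E n)}ᶜ) {t : ℝ} (ht : 0 < t) {x : E n} (hx : x ≠ 0) :
    t • hess H (t • x) = hess H x := by
  have hx' : t • x ≠ 0 := smul_ne_zero ht.ne' hx
  have h1 : HasFDerivAt (fun y => gradient H (t • y))
      ((hess H (t • x)).comp (t • ContinuousLinearMap.id ℝ (E n))) x :=
    (hasFDerivAt_gradient hs hx').comp x ((hasFDerivAt_id x).const_smul t)
  have h2 : HasFDerivAt (fun y => gradient H (t • y)) (hess H x) x := by
    refine (hasFDerivAt_gradient hs hx).congr_of_eventuallyEq ?_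
    filter_upwards [isOpen_compl_singleton.mem_nhds hx] with y hy
      using gradient_smul_of_pos hh hs ht hy
  rw [← h1.unique h2]
  ext1 v
  simp

theorem hess_apply_self (hh : ∀ (t : ℝ) (x : E n), 0 < t → H (t • x) = t * H x)
    (hs : ContDiffOn ℝ (⊤ : ℕ∞) H {(0 : E n)}ᶜ) {x : E n} (hx : x ≠ 0) : hess H x x = 0 := by
  have h0 : HasDerivAt (fun t : ℝ => t • x) x 1 := by
    simpa using (hasDerivAt_id (1 : ℝ)).smul_const x
  have h1 : HasDerivAt (fun t : ℝ => gradient H (t • x)) (hess H x x) 1 := by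
    have := hasFDerivAt_gradient hs hx
    rw [← one_smul ℝ x] at this
    simpa [Function.comp_def] using this.comp_hasDerivAt (1 : ℝ) h0
  refine h1.unique ((hasDerivAt_const (1 : ℝ) (gradient H x)).congr_of_eventuallyEq ?_)
  filter_upwards [lt_mem_nhds (zero_lt_one (α := ℝ))] with t ht
    using gradient_smul_of_pos hh hs ht hx

/-- Second-order Taylor formula with Lagrange remainder along a segment avoiding the origin. -/
theorem exists_taylor_hess (hs : ContDiffOn ℝ (⊤ : ℕ∞) H {(0 : E n)}ᶜ) {x v : E n}
    (hseg : ∀ t ∈ Set.Icc (0 : ℝ) 1, x + t • v ≠ 0) :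
    ∃ t ∈ Set.Ioo (0 : ℝ) 1,
      H (x + v) = H x + ⟪gradient H x, v⟫ + ⟪hess H (x + t • v) v, v⟫ / 2 := by
  have hγ : ∀ t : ℝ, HasDerivAt (fun t : ℝ => x + t • v) v t := fun t => by
    simpa using ((hasDerivAt_id t).smul_const v).const_add x
  have h1 : ∀ t ∈ Set.Icc (0 : ℝ) 1,
      HasDerivAt (fun t : ℝ => H (x + t • v)) ⟪gradient H (x + t • v), v⟫ t := fun t ht => by
    simpa [Function.comp_def] using
      (hasGradientAt_of_contDiffOn hs (hseg t ht)).hasFDerivAt.comp_hasDerivAt t (hγ t)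
  have h2 : ∀ t ∈ Set.Icc (0 : ℝ) 1, HasDerivAt (fun t : ℝ => ⟪gradient H (x + t • v), v⟫)
      ⟪hess H (x + t • v) v, v⟫ t := fun t ht => by
    have := ((hasFDerivAt_gradient hs (hseg t ht)).comp_hasDerivAt t (hγ t)).inner ℝ
      (hasDerivAt_const t v)
    simpa using this
  have h3 : ∀ t ∈ Set.Icc (0 : ℝ) 1,
      HasDerivAt (fun t : ℝ => H (x + t • v) - t * ⟪gradient H x, v⟫)
        (⟪gradient H (x + t • v), v⟫ - ⟪gradient H x, v⟫) t := fun t ht => by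
    simpa using (h1 t ht).fun_sub ((hasDerivAt_id t).mul_const ⟪gradient H x, v⟫)
  obtain ⟨s, hs1, hs2⟩ := exists_ratio_hasDerivAt_eq_ratio_slope
    (fun t : ℝ => H (x + t • v) - t * ⟪gradient H x, v⟫)
    (fun t => ⟪gradient H (x + t • v), v⟫ - ⟪gradient H x, v⟫) zero_lt_one
    (fun t ht => (h3 t ht).continuousAt.continuousWithinAt)
    (fun t ht => h3 t (Set.Ioo_subset_Icc_self ht)) (fun t : ℝ => t ^ 2) (fun t => 2 * t)
    (by fun_prop) (fun t _ => by simpa using hasDerivAt_pow 2 t)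
  obtain ⟨r, hr1, hr2⟩ := exists_hasDerivAt_eq_slope
    (fun t : ℝ => ⟪gradient H (x + t • v), v⟫) (fun t => ⟪hess H (x + t • v) v, v⟫) hs1.1
    (fun t ht => (h2 t ⟨ht.1, ht.2.trans hs1.2.le⟩).continuousAt.continuousWithinAt)
    (fun t ht => h2 t ⟨ht.1.le, ht.2.le.trans hs1.2.le⟩)
  refine ⟨r, ⟨hr1.1, hr1.2.trans hs1.2⟩, ?_⟩
  have hs0 : s ≠ 0 := hs1.1.ne'
  rw [hr2]
  simp at hs2 ⊢
  field_simp
  linarith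

theorem inner_hess_self_pos (hh : ∀ (t : ℝ) (x : E n), 0 < t → H (t • x) = t * H x)
    (hs : ContDiffOn ℝ (⊤ : ℕ∞) H {(0 : E n)}ᶜ)
    (hc : ∀ x ∈ sphere (0 : E n) 1, ∀ v : E n, ⟪v, x⟫ = 0 → v ≠ 0 → 0 < ⟪(hess H x) v, v⟫)
    {x v : E n} (hx : x ≠ 0) (hv : ∀ c : ℝ, v ≠ c • x) : 0 < ⟪hess H x v, v⟫ := by
  have hn : 0 < ‖x‖ := norm_pos_iff.2 hx
  have hn2 : ⟪x, x⟫ ≠ 0 := by simpa using hx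
  set c : ℝ := ⟪v, x⟫ / ⟪x, x⟫ with hcdef
  set w := v - c • x with hw
  have hwx : ⟪w, x⟫ = 0 := by
    rw [hw, inner_sub_left, real_inner_smul_left, hcdef]
    field_simp
    simp
  have hw0 : w ≠ 0 := sub_ne_zero.2 (hv c)
  have hvw : v = w + c • x := by simp [hw]
  have h1 : ⟪hess H x v, v⟫ = ⟪hess H x w, w⟫ := by
    rw [hvw, map_add, map_smul, hess_apply_self hh hs hx, smul_zero, add_zero, inner_add_right,
      inner_smul_right, inner_hess_comm hs hx w x, hess_apply_self hh hs hx]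
    simp
  rw [h1]
  have hu : ‖x‖⁻¹ • x ∈ sphere (0 : E n) 1 := by simp [norm_smul, hn.ne']
  have h2 := hc _ hu w (by rw [inner_smul_right, hwx, mul_zero]) hw0
  have h3 := hess_smul_of_pos hh hs (inv_pos.2 hn) hx
  rw [← h3, smul_apply, real_inner_smul_left]
  exact mul_pos (inv_pos.2 hn) h2

/-- The support-plane inequality, strict off the ray through `x`. -/
theorem inner_gradient_lt (hh : ∀ (t : ℝ) (x : E n), 0 < t → H (t • x) = t * H x)
    (hs : ContDiffOn ℝ (⊤ : ℕ∞) H {(0 : E n)}ᶜ)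
    (hp : ∀ x ∈ sphere (0 : E n) 1, 0 < H x)
    (hc : ∀ x ∈ sphere (0 : E n) 1, ∀ v : E n, ⟪v, x⟫ = 0 → v ≠ 0 → 0 < ⟪(hess H x) v, v⟫)
    {x y : E n} (hx : x ≠ 0) (hy : y ≠ 0) (hxy : ∀ c : ℝ, 0 < c → y ≠ c • x) :
    ⟪gradient H x, y⟫ < H y := by
  have hpos : ∀ z : E n, z ≠ 0 → 0 < H z := by
    intro z hz
    have hn : 0 < ‖z‖ := norm_pos_iff.2 hz
    have h := hp (‖z‖⁻¹ • z) (by simp [norm_smul, hn.ne'])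
    rw [hh _ _ (inv_pos.2 hn)] at h
    exact pos_of_mul_pos_right h (inv_pos.2 hn).le
  by_cases hcol : ∃ c : ℝ, y = c • x
  · obtain ⟨c, rfl⟩ := hcol
    have hc0 : c ≤ 0 := not_lt.1 fun h => hxy c h rfl
    rw [inner_smul_right, inner_gradient_self hh hs hx]
    exact (mul_nonpos_of_nonpos_of_nonneg hc0 (hpos x hx).le).trans_lt (hpos _ hy)
  · push Not at hcol
    have hcol' : ∀ t : ℝ, x + t • (y - x) ≠ 0 := by
      intro t ht
      rcases eq_or_ne t 0 with rfl | ht0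
      · simp [hx] at ht
      · refine hcol (-(1 - t) / t) ?_
        have : t • y = (-(1 - t)) • x := by
          rw [eq_comm, ← sub_eq_zero, ← neg_eq_zero, ← ht]; module
        rw [div_eq_inv_mul, mul_smul, ← this, smul_smul, inv_mul_cancel₀ ht0, one_smul]
    obtain ⟨t, -, ht⟩ := exists_taylor_hess hs fun t _ => hcol' t
    have hq : 0 < ⟪hess H (x + t • (y - x)) (y - x), y - x⟫ := by
      refine inner_hess_self_pos hh hs hc (hcol' t) fun c hcc => ?_
      have h1 : (1 - c * t) • y = (1 + c - c * t) • x := by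
        rw [← sub_eq_zero] at hcc ⊢
        rw [← hcc]; module
      by_cases h2 : 1 - c * t = 0
      · have h3 : (1 + c - c * t) • x = 0 := by rw [← h1, h2, zero_smul]
        have h4 : 1 + c - c * t = 0 := (smul_eq_zero.1 h3).resolve_right hx
        have h5 : c = 0 := by linarith
        simp [h5] at h2
      · refine hcol ((1 - c * t)⁻¹ * (1 + c - c * t)) ?_
        rw [mul_smul, ← h1, smul_smul, inv_mul_cancel₀ h2, one_smul]
    rw [inner_sub_right, inner_gradient_self hh hs hx, add_sub_cancel] at ht
    linarith

theorem inner_gradient_le (hh : ∀ (t : ℝ) (x : E n), 0 < t → H (t • x) = t * H x)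
    (hs : ContDiffOn ℝ (⊤ : ℕ∞) H {(0 : E n)}ᶜ)
    (hp : ∀ x ∈ sphere (0 : E n) 1, 0 < H x)
    (hc : ∀ x ∈ sphere (0 : E n) 1, ∀ v : E n, ⟪v, x⟫ = 0 → v ≠ 0 → 0 < ⟪(hess H x) v, v⟫)
    {x y : E n} (hx : x ≠ 0) (hy : y ≠ 0) : ⟪gradient H x, y⟫ ≤ H y := by
  by_cases h : ∀ c : ℝ, 0 < c → y ≠ c • x
  · exact (inner_gradient_lt hh hs hp hc hx hy h).le
  · push Not at h
    obtain ⟨c, hc0, rfl⟩ := h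
    rw [inner_smul_right, inner_gradient_self hh hs hx, hh c x hc0]

end Calculus

/-- `H` is the support function of a smooth strictly convex body containing the origin in its
interior and satisfying `𝒦 = H` on the unit sphere. -/
structure IsSelfSimilarSupport {n : ℕ} (H : E n → ℝ) : Prop where
  hom : ∀ (t : ℝ) (x : E n), 0 < t → H (t • x) = t * H x
  smooth : ContDiffOn ℝ (⊤ : ℕ∞) H {(0 : E n)}ᶜ
  pos : ∀ x ∈ sphere (0 : E n) 1, 0 < H x
  convex : ∀ x ∈ sphere (0 : E n) 1, ∀ v : E n, ⟪v, x⟫ = 0 → v ≠ 0 → 0 < ⟪(hess H x) v, v⟫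
  flow : ∀ x ∈ sphere (0 : E n) 1, (sigmaDet H x)⁻¹ = H x

/-- The homogeneous map `x ↦ ‖x‖ ∇H(x)`. -/
def normSmulGradient {n : ℕ} (H : E n → ℝ) (x : E n) : E n := ‖x‖ • gradient H x

section NormSmulGradient

variable {n : ℕ} {H : E n → ℝ}

theorem inv_norm_smul_mem_sphere {x : E n} (hx : x ≠ 0) : ‖x‖⁻¹ • x ∈ sphere (0 : E n) 1 := by
  simp [norm_smul, hx]

theorem hasFDerivAt_norm' {x : E n} (hx : x ≠ 0) :
    HasFDerivAt (fun y : E n => ‖y‖) (‖x‖⁻¹ • innerSL ℝ x) x := by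
  have h := (hasStrictFDerivAt_norm_sq x).hasFDerivAt.sqrt (by simpa using hx)
  simp only [Real.sqrt_sq (norm_nonneg _)] at h
  refine h.congr_fderiv ?_
  ext v
  simp
  ring

namespace IsSelfSimilarSupport

theorem pos_of_ne_zero (h : IsSelfSimilarSupport H) {x : E n} (hx : x ≠ 0) : 0 < H x := by
  have h1 := h.pos _ (inv_norm_smul_mem_sphere hx)
  rw [h.hom _ _ (inv_pos.2 (norm_pos_iff.2 hx))] at h1
  exact pos_of_mul_pos_right h1 (inv_pos.2 (norm_pos_iff.2 hx)).le

theorem hasFDerivAt_normSmulGradient (h : IsSelfSimilarSupport H) {x : E n} (hx : x ≠ 0) :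
    HasFDerivAt (normSmulGradient H)
      (hess H (‖x‖⁻¹ • x) +
        (innerSL ℝ (‖x‖⁻¹ • x)).smulRight (gradient H (‖x‖⁻¹ • x))) x := by
  have hn := norm_pos_iff.2 hx
  have h1 := (hasFDerivAt_norm' hx).smul (hasFDerivAt_gradient h.smooth hx)
  rw [gradient_smul_of_pos h.hom h.smooth (inv_pos.2 hn) hx,
    ← hess_smul_of_pos h.hom h.smooth hn (x := ‖x‖⁻¹ • x) (by simp [hx]), smul_smul,
    mul_inv_cancel₀ hn.ne', one_smul, map_smul]
  exact h1

theorem det_fderiv_normSmulGradient (h : IsSelfSimilarSupport H) {x : E n}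
    (hx : x ∈ sphere (0 : E n) 1) :
    (hess H x + (innerSL ℝ x).smulRight (gradient H x)).det = 1 := by
  have hx1 : ‖x‖ = 1 := by simpa using hx
  have hx0 : x ≠ 0 := by rintro rfl; simp at hx1
  have hxx : ⟪x, x⟫ = 1 := by simp [hx1]
  set M : E n →L[ℝ] E n := hess H x + proj x with hM
  have hdet : LinearMap.det M.toLinearMap * H x = 1 := by
    have h1 := h.flow x hx
    have h2 : sigmaDet H x ≠ 0 := fun h0 => by
      have := h.pos x hx
      rw [← h1, h0] at this
      simp at this
    rw [← h1]
    exact mul_inv_cancel₀ h2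
  have hunit : IsUnit (LinearMap.det M.toLinearMap) := IsUnit.of_mul_eq_one _ hdet
  obtain ⟨p, hp⟩ : ∃ p, M p = gradient H x - x :=
    ((LinearMap.isUnit_iff_range_eq_top _).1 ((LinearMap.isUnit_iff_isUnit_det _).2 hunit)).ge
      (Submodule.mem_top (x := gradient H x - x))
  have hxp : ⟪x, p⟫ = H x - 1 := by
    have h1 : ⟪x, M p⟫ = ⟪x, p⟫ := by
      simp [hM, proj, inner_add_right, inner_smul_right,
        ← inner_hess_comm h.smooth hx0 x p, hess_apply_self h.hom h.smooth hx0, hx1]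
    rw [← h1, hp, inner_sub_right, real_inner_comm, inner_gradient_self h.hom h.smooth hx0, hxx]
  have hcomp : ((hess H x + (innerSL ℝ x).smulRight (gradient H x) : E n →L[ℝ] E n) :
      E n →ₗ[ℝ] E n) =
      M.toLinearMap ∘ₗ LinearMap.transvection ((innerSL ℝ x : E n →L[ℝ] ℝ) : E n →ₗ[ℝ] ℝ) p := by
    ext1 v
    have : gradient H x = M p + x := by rw [hp]; abel
    simp [LinearMap.transvection.apply, this, hM, proj, inner_add_right, inner_smul_right]
    module
  change LinearMap.det _ = 1
  rw [hcomp, LinearMap.det_comp, LinearMap.transvection.det]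
  change LinearMap.det M.toLinearMap * (1 + ⟪x, p⟫) = 1
  rw [hxp, ← hdet]
  ring

theorem normSmulGradient_smul (h : IsSelfSimilarSupport H) {t : ℝ} (ht : 0 < t) {x : E n}
    (hx : x ≠ 0) : normSmulGradient H (t • x) = t • normSmulGradient H x := by
  rw [normSmulGradient, normSmulGradient, gradient_smul_of_pos h.hom h.smooth ht hx, norm_smul,
    Real.norm_of_nonneg ht.le, mul_smul]

theorem injOn_normSmulGradient (h : IsSelfSimilarSupport H) :
    Set.InjOn (normSmulGradient H) {(0 : E n)}ᶜ := by
  have key : ∀ x y : E n, x ≠ 0 → y ≠ 0 → normSmulGradient H x = normSmulGradient H y →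
      ‖y‖ ≤ ‖x‖ ∧ (‖x‖ = ‖y‖ → x = y) := by
    intro x y hx hy hxy
    have h1 : ⟪normSmulGradient H x, y⟫ = ‖y‖ * H y := by
      rw [hxy, normSmulGradient, real_inner_smul_left, inner_gradient_self h.hom h.smooth hy]
    rw [normSmulGradient, real_inner_smul_left] at h1
    have hHy := h.pos_of_ne_zero hy
    constructor
    · have h2 := inner_gradient_le h.hom h.smooth h.pos h.convex hx hy
      have h3 := mul_le_mul_of_nonneg_left h2 (norm_nonneg x)
      rw [h1] at h3
      exact le_of_mul_le_mul_right h3 hHy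
    · intro hn
      by_contra hne
      have h2 := inner_gradient_lt h.hom h.smooth h.pos h.convex hx hy fun c hc hcx => by
        rw [hcx, norm_smul, Real.norm_of_nonneg hc.le] at hn
        have : c = 1 := by
          have := norm_pos_iff.2 hx
          nlinarith
        rw [this, one_smul] at hcx
        exact hne hcx.symm
      rw [hn] at h1
      exact h2.ne (mul_left_cancel₀ (norm_pos_iff.2 hy).ne' h1)
  intro x hx y hy hxy
  have h1 := key x y hx hy hxy
  have h2 := key y x hy hx hxy.symm
  exact h1.2 (le_antisymm h2.1 h1.1)

theorem exists_normSmulGradient_eq (h : IsSelfSimilarSupport H) {y : E n} (hy : y ≠ 0) :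
    ∃ x : E n, x ≠ 0 ∧ normSmulGradient H x = y := by
  have hne : ∀ x ∈ sphere (0 : E n) 1, x ≠ 0 := fun x hx => ne_of_mem_sphere hx one_ne_zero
  have hcont : ContinuousOn (fun x : E n => ⟪y, x⟫ / H x) (sphere 0 1) :=
    ContinuousOn.div (by fun_prop) (h.smooth.continuousOn.mono fun x hx => hne x hx)
      fun x hx => (h.pos x hx).ne'
  obtain ⟨x, hx, hmax⟩ := (isCompact_sphere (0 : E n) 1).exists_isMaxOn
    ⟨_, inv_norm_smul_mem_sphere hy⟩ hcont
  set ρ := ⟪y, x⟫ / H x with hρ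
  have hle : ∀ z : E n, z ≠ 0 → ⟪y, z⟫ ≤ ρ * H z := by
    intro z hz
    have hn := norm_pos_iff.2 hz
    have h1 : ⟪y, ‖z‖⁻¹ • z⟫ / H (‖z‖⁻¹ • z) ≤ ρ := hmax (inv_norm_smul_mem_sphere hz)
    rw [h.hom _ _ (inv_pos.2 hn), inner_smul_right,
      mul_div_mul_left _ _ (inv_ne_zero hn.ne')] at h1
    exact (div_le_iff₀ (h.pos_of_ne_zero hz)).1 h1
  have hρ0 : 0 < ρ := by
    have h1 := hle y hy
    have h2 : 0 < ⟪y, y⟫ := real_inner_self_pos.2 hy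
    exact pos_of_mul_pos_left (h2.trans_le h1) (h.pos_of_ne_zero hy).le
  have hx0 := hne x hx
  have hx1 : ‖x‖ = 1 := by simpa using hx
  refine ⟨ρ • x, smul_ne_zero hρ0.ne' hx0, ?_⟩
  rw [h.normSmulGradient_smul hρ0 hx0, normSmulGradient, hx1, one_smul]
  have hd : HasFDerivAt (fun z => ⟪y, z⟫ - ρ * H z)
      (innerSL ℝ y - ρ • InnerProductSpace.toDual ℝ (E n) (gradient H x)) x :=
    (innerSL ℝ y).hasFDerivAt.sub
      ((hasGradientAt_of_contDiffOn h.smooth hx0).hasFDerivAt.const_mul ρ)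
  have hloc : IsLocalMax (fun z => ⟪y, z⟫ - ρ * H z) x := by
    filter_upwards [isOpen_compl_singleton.mem_nhds hx0] with z hz
    have h1 : ⟪y, x⟫ - ρ * H x = 0 := by
      rw [hρ, div_mul_cancel₀ _ (h.pos x hx).ne', sub_self]
    rw [h1]
    linarith [hle z hz]
  have h0 := hloc.hasFDerivAt_eq_zero hd
  refine ext_inner_right ℝ fun v => ?_
  have h1 := congrArg (fun L : E n →L[ℝ] ℝ => L v) h0
  simp [sub_eq_zero] at h1
  rw [real_inner_smul_left]
  simpa using h1.symm

theorem volume_image_normSmulGradient (h : IsSelfSimilarSupport H) {D : Set (E n)}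
    (hD : MeasurableSet D) (hD0 : D ⊆ {0}ᶜ) : volume (normSmulGradient H '' D) = volume D := by
  rw [← lintegral_abs_det_fderiv_eq_addHaar_image volume hD
    (fun x hx => (h.hasFDerivAt_normSmulGradient (hD0 hx)).hasFDerivWithinAt)
    (h.injOn_normSmulGradient.mono hD0), setLIntegral_congr_fun (g := fun _ => 1) hD]
  · simp
  · intro x hx
    beta_reduce
    rw [h.det_fderiv_normSmulGradient (inv_norm_smul_mem_sphere (hD0 hx))]
    simp

theorem measurableSet_image_normSmulGradient (h : IsSelfSimilarSupport H) {D : Set (E n)}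
    (hD : MeasurableSet D) (hD0 : D ⊆ {0}ᶜ) : MeasurableSet (normSmulGradient H '' D) :=
  measurable_image_of_fderivWithin hD
    (fun _ hx => (h.hasFDerivAt_normSmulGradient (hD0 hx)).hasFDerivWithinAt)
    (h.injOn_normSmulGradient.mono hD0)

end IsSelfSimilarSupport

end NormSmulGradient

section Perturbation

variable {n : ℕ} {H : E n → ℝ}

/-- The punctured star-shaped region with radial function `r`. -/
def starRegion {n : ℕ} (r : E n → ℝ) : Set (E n) := {x | x ≠ 0 ∧ ‖x‖ < r (‖x‖⁻¹ • x)}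

/-- The component of the Gauss map inverse in direction `e`, recentred at `m`. -/
def centredComponent {n : ℕ} (H : E n → ℝ) (e : E n) (m : ℝ) (x : E n) : ℝ :=
  ⟪gradient H x, e⟫ - m

/-- The second-order coefficient in the expansion of the perturbed support function. -/
def secondOrderCoeff {n : ℕ} (H : E n → ℝ) (e : E n) (m ε : ℝ) (x : E n) : ℝ :=
  centredComponent H e m x ^ 2 + H x * ⟪hess H x e, e⟫ / 2 + ε

/-- The perturbed support function. -/
def perturbedSupport {n : ℕ} (H : E n → ℝ) (e : E n) (m ε t : ℝ) (x : E n) : ℝ :=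
  H x * (1 + t * centredComponent H e m x + t ^ 2 * secondOrderCoeff H e m ε x)

theorem measurableSet_starRegion {r : E n → ℝ} (hr : Measurable r) :
    MeasurableSet (starRegion r) :=
  (measurableSet_singleton 0).compl.inter
    (measurableSet_lt measurable_norm (hr.comp (by fun_prop)))

theorem starRegion_subset (r : E n → ℝ) : starRegion r ⊆ {0}ᶜ := fun _ hx => hx.1

theorem measurable_gradient (H : E n → ℝ) : Measurable (gradient H) :=
  (InnerProductSpace.toDual ℝ (E n)).symm.continuous.measurable.comp (measurable_fderiv ℝ H)

theorem measurable_hess_apply (H : E n → ℝ) (v : E n) : Measurable fun x => hess H x v :=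
  measurable_fderiv_apply_const ℝ _ v

namespace IsSelfSimilarSupport

theorem continuousAt (h : IsSelfSimilarSupport H) {x : E n} (hx : x ≠ 0) : ContinuousAt H x :=
  h.smooth.continuousOn.continuousAt (isOpen_compl_singleton.mem_nhds hx)

theorem continuousAt_gradient (h : IsSelfSimilarSupport H) {x : E n} (hx : x ≠ 0) :
    ContinuousAt (gradient H) x :=
  (contDiffOn_gradient h.smooth).continuousOn.continuousAt (isOpen_compl_singleton.mem_nhds hx)

theorem continuousAt_hess (h : IsSelfSimilarSupport H) {x : E n} (hx : x ≠ 0) :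
    ContinuousAt (hess H) x :=
  (contDiffOn_hess h.smooth).continuousOn.continuousAt (isOpen_compl_singleton.mem_nhds hx)

theorem continuousAt_centredComponent (h : IsSelfSimilarSupport H) (e : E n) (m : ℝ) {x : E n}
    (hx : x ≠ 0) : ContinuousAt (centredComponent H e m) x :=
  ((h.continuousAt_gradient hx).inner continuousAt_const).sub continuousAt_const

theorem continuousAt_secondOrderCoeff (h : IsSelfSimilarSupport H) (e : E n) (m ε : ℝ) {x : E n}
    (hx : x ≠ 0) : ContinuousAt (secondOrderCoeff H e m ε) x :=
  (((h.continuousAt_centredComponent e m hx).pow 2).add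
    (((h.continuousAt hx).mul (((h.continuousAt_hess hx).clm_apply continuousAt_const).inner
      continuousAt_const)).div_const 2)).add continuousAt_const

theorem measurable (h : IsSelfSimilarSupport H) : Measurable H :=
  measurable_of_continuousOn_compl_singleton 0 h.smooth.continuousOn

theorem measurable_centredComponent (e : E n) (m : ℝ) : Measurable (centredComponent H e m) :=
  ((measurable_gradient H).inner measurable_const).sub_const m

theorem measurable_secondOrderCoeff (h : IsSelfSimilarSupport H) (e : E n) (m ε : ℝ) :
    Measurable (secondOrderCoeff H e m ε) :=
  (((measurable_centredComponent e m).pow_const 2).add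
    ((h.measurable.mul ((measurable_hess_apply H e).inner measurable_const)).div_const 2)).add_const
      ε

theorem eventually_le_perturbedSupport (h : IsSelfSimilarSupport H) (e : E n) (m : ℝ) {ε : ℝ}
    (hε : 0 < ε) : ∀ᶠ t in nhds (0 : ℝ), ∀ x ∈ sphere (0 : E n) 1,
      0 < perturbedSupport H e m ε t x ∧ x + (t * perturbedSupport H e m ε t x) • e ≠ 0 ∧
      H (x + (t * perturbedSupport H e m ε t x) • e) ≤
        perturbedSupport H e m ε t x * (1 + t * m) := by
  refine (isCompact_sphere (0 : E n) 1).eventually_forall_of_forall_eventually fun x₀ hx₀ => ?_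
  have hx0 : x₀ ≠ 0 := ne_of_mem_sphere hx₀ one_ne_zero
  have hcY : ∀ s : ℝ, ContinuousAt (fun p : (ℝ × E n) × ℝ => centredComponent H e m p.1.2)
      ((0, x₀), s) := fun s =>
    (h.continuousAt_centredComponent e m hx0).comp_of_eq (by fun_prop) rfl
  have hcQ : ∀ s : ℝ, ContinuousAt (fun p : (ℝ × E n) × ℝ => secondOrderCoeff H e m ε p.1.2)
      ((0, x₀), s) := fun s =>
    (h.continuousAt_secondOrderCoeff e m ε hx0).comp_of_eq (by fun_prop) rfl
  have hcH : ∀ s : ℝ, ContinuousAt (fun p : (ℝ × E n) × ℝ => H p.1.2) ((0, x₀), s) := fun s =>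
    (h.continuousAt hx0).comp_of_eq (by fun_prop) rfl
  have hcq : ∀ s : ℝ, ContinuousAt (fun p : (ℝ × E n) × ℝ => ⟪hess H p.1.2 e, e⟫)
      ((0, x₀), s) := fun s =>
    (((h.continuousAt_hess hx0).comp_of_eq (f := fun p : (ℝ × E n) × ℝ => p.1.2)
      (by fun_prop) rfl).clm_apply continuousAt_const).inner continuousAt_const
  have hct : ∀ s : ℝ, ContinuousAt (fun p : (ℝ × E n) × ℝ => p.1.1) ((0, x₀), s) := fun s => by
    fun_prop
  have hcr : ∀ s : ℝ, ContinuousAt (fun p : (ℝ × E n) × ℝ => 1 + p.1.1 *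
      centredComponent H e m p.1.2 + p.1.1 ^ 2 * secondOrderCoeff H e m ε p.1.2)
      ((0, x₀), s) := fun s =>
    (continuousAt_const.add ((hct s).mul (hcY s))).add (((hct s).pow 2).mul (hcQ s))
  have hcξ : ∀ s : ℝ, ContinuousAt (fun p : (ℝ × E n) × ℝ => p.1.2 +
      p.2 • ((p.1.1 * perturbedSupport H e m ε p.1.1 p.1.2) • e)) ((0, x₀), s) := fun s => by
    have h1 : ContinuousAt (fun p : (ℝ × E n) × ℝ => perturbedSupport H e m ε p.1.1 p.1.2)
        ((0, x₀), s) := (hcH s).mul (hcr s)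
    have h2 := ((hct s).mul h1).smul (continuousAt_const (y := e))
    have h3 : ContinuousAt (fun p : (ℝ × E n) × ℝ => p.1.2) ((0, x₀), s) := by fun_prop
    have h4 : ContinuousAt (fun p : (ℝ × E n) × ℝ => p.2) ((0, x₀), s) := by fun_prop
    exact h3.add (h4.smul h2)
  have hev : ∀ᶠ p : ℝ × E n in nhds (0, x₀), ∀ s ∈ Set.Icc (0 : ℝ) 1,
      p.2 + s • ((p.1 * perturbedSupport H e m ε p.1 p.2) • e) ≠ 0 ∧
      p.1 * secondOrderCoeff H e m ε p.2 * centredComponent H e m p.2 +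
        (1 + p.1 * centredComponent H e m p.2 + p.1 ^ 2 * secondOrderCoeff H e m ε p.2) ^ 2 *
        (H p.2 * ⟪hess H (p.2 + s • ((p.1 * perturbedSupport H e m ε p.1 p.2) • e)) e, e⟫ / 2) <
        H p.2 * ⟪hess H p.2 e, e⟫ / 2 + ε := by
    refine isCompact_Icc.eventually_forall_of_forall_eventually fun s _ => ?_
    have hcqξ : ContinuousAt (fun p : (ℝ × E n) × ℝ => ⟪hess H (p.1.2 +
        p.2 • ((p.1.1 * perturbedSupport H e m ε p.1.1 p.1.2) • e)) e, e⟫) ((0, x₀), s) :=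
      (((h.continuousAt_hess hx0).comp_of_eq (hcξ s) (by simp)).clm_apply
        continuousAt_const).inner continuousAt_const
    refine ((hcξ s).eventually_ne (by simpa using hx0)).and ?_
    refine ContinuousAt.eventually_lt
      ((((hct s).mul (hcQ s)).mul (hcY s)).add (((hcr s).pow 2).mul
        (((hcH s).mul hcqξ).div_const 2)))
      ((((hcH s).mul (hcq s)).div_const 2).add continuousAt_const) ?_
    simp [hε]
  have hpos : ∀ᶠ p : ℝ × E n in nhds (0, x₀), 0 < H p.2 := by
    have h1 : ContinuousAt (fun p : ℝ × E n => H p.2) (0, x₀) :=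
      (h.continuousAt hx0).comp_of_eq (by fun_prop) rfl
    exact continuousAt_const.eventually_lt h1 (h.pos x₀ hx₀)
  have hpos' : ∀ᶠ p : ℝ × E n in nhds (0, x₀), 0 < perturbedSupport H e m ε p.1 p.2 := by
    have h1 : ContinuousAt (fun p : ℝ × E n => perturbedSupport H e m ε p.1 p.2) (0, x₀) :=
      ((hcH 0).mul (hcr 0)).comp_of_eq (f := fun p : ℝ × E n => (p, (0 : ℝ))) (by fun_prop) rfl
    exact continuousAt_const.eventually_lt h1 (by simpa [perturbedSupport] using h.pos x₀ hx₀)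
  filter_upwards [hev, hpos, hpos'] with ⟨t, x⟩ h1 h2 h2'
  dsimp only at h1 h2 h2' ⊢
  refine ⟨h2', by simpa using (h1 1 (by simp)).1, ?_⟩
  obtain ⟨s, hs, hs'⟩ := exists_taylor_hess h.smooth fun s hs => (h1 s hs).1
  have h3 := (h1 s (Set.Ioo_subset_Icc_self hs)).2
  rw [hs']
  set q := ⟪hess H (x + s • ((t * perturbedSupport H e m ε t x) • e)) e, e⟫
  have h4 : ⟪gradient H x, e⟫ = centredComponent H e m x + m := by simp [centredComponent]
  simp only [map_smul, inner_smul_left, inner_smul_right, h4]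
  change _ + _ + (t * _) * ((t * _) * q) / 2 ≤ _
  have h5 : secondOrderCoeff H e m ε x =
    centredComponent H e m x ^ 2 + H x * ⟪hess H x e, e⟫ / 2 + ε := rfl
  rw [perturbedSupport]
  set Y := centredComponent H e m x
  set Q := secondOrderCoeff H e m ε x
  set a := H x * ⟪hess H x e, e⟫ / 2
  nlinarith [mul_le_mul_of_nonneg_left h3.le (mul_nonneg h2.le (sq_nonneg t))]

/-- The midpoint inclusion followed by the Brunn–Minkowski inequality. -/
theorem eventually_volume_mul_volume_le (h : IsSelfSimilarSupport H) (e : E n) (m : ℝ) {ε : ℝ}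
    (hε : 0 < ε) : ∀ᶠ t in nhds (0 : ℝ),
      volume (starRegion fun x => (1 - t * centredComponent H e m x)⁻¹) *
        volume (starRegion fun x => (1 + t * centredComponent H e m x)⁻¹) ≤
      volume (starRegion fun x => 1 + t ^ 2 * secondOrderCoeff H e m ε x) ^ 2 := by
  have hev := h.eventually_le_perturbedSupport e m hε
  have hev' : ∀ᶠ t in nhds (0 : ℝ), ∀ x ∈ sphere (0 : E n) 1,
      0 < perturbedSupport H e m ε (-t) x ∧ x + (-t * perturbedSupport H e m ε (-t) x) • e ≠ 0 ∧
      H (x + (-t * perturbedSupport H e m ε (-t) x) • e) ≤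
        perturbedSupport H e m ε (-t) x * (1 + -t * m) := by
    have : Filter.Tendsto (fun t : ℝ => -t) (nhds 0) (nhds 0) := by
      simpa using (continuous_neg (G := ℝ)).tendsto 0
    exact this.eventually hev
  filter_upwards [hev, hev'] with t ht ht'
  have key : ∀ t : ℝ, (∀ x ∈ sphere (0 : E n) 1,
      0 < perturbedSupport H e m ε t x ∧ x + (t * perturbedSupport H e m ε t x) • e ≠ 0 ∧
      H (x + (t * perturbedSupport H e m ε t x) • e) ≤
        perturbedSupport H e m ε t x * (1 + t * m)) →
      ∀ z ∈ normSmulGradient H '' starRegion fun x => (1 - t * centredComponent H e m x)⁻¹,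
      ∀ u ∈ sphere (0 : E n) 1, ⟪z, u⟫ < perturbedSupport H e m ε t u := by
    rintro t ht _ ⟨x, ⟨hx0, hx⟩, rfl⟩ u hu
    obtain ⟨hl, hu0, hu1⟩ := ht u hu
    have hn := norm_pos_iff.2 hx0
    dsimp only at hx
    have hY : centredComponent H e m (‖x‖⁻¹ • x) = ⟪gradient H x, e⟫ - m := by
      rw [centredComponent, gradient_smul_of_pos h.hom h.smooth (inv_pos.2 hn) hx0]
    rw [hY] at hx
    have h1 : 0 < 1 - t * (⟪gradient H x, e⟫ - m) := inv_pos.1 (hn.trans hx)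
    have h2 : ‖x‖ * (1 - t * (⟪gradient H x, e⟫ - m)) < 1 := by
      have := mul_lt_mul_of_pos_right hx h1
      rwa [inv_mul_cancel₀ h1.ne'] at this
    have h3 := inner_gradient_le h.hom h.smooth h.pos h.convex hx0 hu0
    rw [inner_add_right, inner_smul_right] at h3
    rw [normSmulGradient, real_inner_smul_left]
    have h4 := mul_le_mul_of_nonneg_left (h3.trans hu1) hn.le
    have h5 := mul_lt_mul_of_pos_left h2 hl
    nlinarith
  set A := starRegion fun x => (1 - t * centredComponent H e m x)⁻¹ with hA
  set B := starRegion fun x => (1 + t * centredComponent H e m x)⁻¹ with hB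
  set C := starRegion fun x => 1 + t ^ 2 * secondOrderCoeff H e m ε x with hC
  have hB' : B = starRegion fun x => (1 - -t * centredComponent H e m x)⁻¹ := by
    simp [hB]
  have hAm : MeasurableSet A := measurableSet_starRegion
    (((measurable_centredComponent e m).const_mul t).const_sub 1).inv
  have hBm : MeasurableSet B := measurableSet_starRegion
    (((measurable_centredComponent e m).const_mul t).const_add 1).inv
  have hCm : MeasurableSet C := measurableSet_starRegion
    (((h.measurable_secondOrderCoeff e m ε).const_mul (t ^ 2)).const_add 1)
  have hle : volume (normSmulGradient H '' C ∪ {0}) ≤ volume C := by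
    refine (measure_union_le _ _).trans ?_
    rw [h.volume_image_normSmulGradient hCm (starRegion_subset _)]
    simp
  rw [← h.volume_image_normSmulGradient hAm (starRegion_subset _),
    ← h.volume_image_normSmulGradient hBm (starRegion_subset _)]
  refine (brunnMinkowski_midpoint
    (h.measurableSet_image_normSmulGradient hAm (starRegion_subset _))
    (h.measurableSet_image_normSmulGradient hBm (starRegion_subset _))
    ((h.measurableSet_image_normSmulGradient hCm (starRegion_subset _)).union
      (measurableSet_singleton 0)) fun a ha b hb => ?_).trans (pow_le_pow_left' hle 2)
  by_cases hz : (2⁻¹ : ℝ) • (a + b) = 0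
  · exact Or.inr hz
  left
  obtain ⟨x, hx0, hx⟩ := h.exists_normSmulGradient_eq hz
  refine ⟨x, ⟨hx0, ?_⟩, hx⟩
  have hn := norm_pos_iff.2 hx0
  have hu := inv_norm_smul_mem_sphere hx0
  have h1 := key t ht a ha _ hu
  rw [hB'] at hb
  have h2 := key (-t) ht' b hb _ hu
  have h3 : ⟪(2⁻¹ : ℝ) • (a + b), ‖x‖⁻¹ • x⟫ = ‖x‖ * H (‖x‖⁻¹ • x) := by
    rw [← hx, normSmulGradient, real_inner_smul_left, inner_smul_right,
      inner_gradient_self h.hom h.smooth hx0, h.hom _ _ (inv_pos.2 hn)]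
  rw [real_inner_smul_left, inner_add_left] at h3
  have hH := h.pos _ hu
  rw [perturbedSupport] at h1 h2
  dsimp only
  refine lt_of_mul_lt_mul_right ?_ hH.le
  nlinarith

end IsSelfSimilarSupport

end Perturbation

section Polar

variable {n : ℕ}

theorem volume_starRegion {r : E n → ℝ} (hr : Measurable r)
    (hpos : ∀ x ∈ sphere (0 : E n) 1, 0 < r x) :
    volume (starRegion r) = ∫⁻ u : sphere (0 : E n) 1,
      ENNReal.ofReal ((r u) ^ (n + 1) / (n + 1)) ∂(volume : Measure (E n)).toSphere := by
  have hmp := MeasurePreserving.symm (homeomorphUnitSphereProd (E n)).toMeasurableEquiv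
    (Measure.measurePreserving_homeomorphUnitSphereProd (volume : Measure (E n)))
  have hdim : Module.finrank ℝ (E n) - 1 = n := by simp
  rw [hdim] at hmp
  have hm : MeasurableSet ((↑) ⁻¹' starRegion r : Set ({0}ᶜ : Set (E n))) :=
    measurable_subtype_coe (measurableSet_starRegion hr)
  have h1 : volume (starRegion r) =
      (volume : Measure (E n)).comap (Subtype.val : ({0}ᶜ : Set (E n)) → E n)
        ((↑) ⁻¹' starRegion r) := by
    rw [comap_subtype_coe_apply (measurableSet_singleton _).compl, Subtype.image_preimage_coe,
      Set.inter_eq_right.2 (starRegion_subset r)]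
  rw [h1, ← hmp.measure_preimage hm.nullMeasurableSet, Measure.prod_apply (hmp.measurable hm)]
  refine lintegral_congr fun u => ?_
  have hu : ‖(u : E n)‖ = 1 := by simp
  have h2 : Prod.mk u ⁻¹' (⇑(homeomorphUnitSphereProd (E n)).toMeasurableEquiv.symm ⁻¹'
      ((↑) ⁻¹' starRegion r)) = Set.Iio ⟨r u, hpos u u.2⟩ := by
    ext ⟨s, hs⟩
    have hs0 : 0 < s := hs
    have hu0 : (u : E n) ≠ 0 := by rw [← norm_ne_zero_iff, hu]; exact one_ne_zero
    simp [starRegion, norm_smul, hs0.ne', abs_of_pos hs0, smul_smul, hu0, ← Subtype.coe_lt_coe]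
  exact (congrArg _ h2).trans (Measure.volumeIoiPow_apply_Iio n _)

end Polar

section Moments

theorem exists_le_inv_one_sub_pow (N : ℕ) : ∃ C : ℝ, 0 ≤ C ∧ ∀ y : ℝ, |y| ≤ 1 / 2 →
    1 + N * y + N * (N + 1) / 2 * y ^ 2 - C * |y| ^ 3 ≤ (1 - y)⁻¹ ^ N := by
  induction N with
  | zero => exact ⟨0, le_rfl, fun y _ => by simp⟩
  | succ N ih =>
    obtain ⟨C, hC, ih⟩ := ih
    refine ⟨2 * (C + (N + 1) * (N + 2) / 2), by positivity, fun y hy => ?_⟩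
    obtain ⟨hy1, hy2⟩ := abs_le.1 hy
    have h1 : 0 < 1 - y := by linarith
    have h2 : (1 - y)⁻¹ ≤ 2 := by
      rw [inv_le_comm₀ h1 two_pos]; linarith
    have h3 := mul_le_mul_of_nonneg_right (ih y hy) (inv_nonneg.2 h1.le)
    rw [← pow_succ] at h3
    refine le_trans ?_ h3
    have h4 : -|y| ^ 3 ≤ y ^ 3 := by
      rw [← abs_pow]; exact neg_abs_le _
    have h5 : (1 + N * y + N * (N + 1) / 2 * y ^ 2 - C * |y| ^ 3) * (1 - y)⁻¹ =
        1 + (N + 1) * y + (N + 1) * (N + 2) / 2 * y ^ 2 +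
          ((N + 1) * (N + 2) / 2 * y ^ 3 - C * |y| ^ 3) * (1 - y)⁻¹ := by
      field_simp
      ring
    rw [h5]
    have h6 : -((C + (N + 1) * (N + 2) / 2) * |y| ^ 3) ≤
        (N + 1) * (N + 2) / 2 * y ^ 3 - C * |y| ^ 3 := by
      have : (0 : ℝ) ≤ (N + 1) * (N + 2) / 2 := by positivity
      nlinarith
    have h7 := mul_le_mul_of_nonneg_right h6 (inv_nonneg.2 h1.le)
    have h8 : (C + (N + 1) * (N + 2) / 2) * |y| ^ 3 * (1 - y)⁻¹ ≤
        (C + (N + 1) * (N + 2) / 2) * |y| ^ 3 * 2 :=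
      mul_le_mul_of_nonneg_left h2 (by positivity)
    push_cast
    linarith

theorem exists_one_add_pow_le (N : ℕ) : ∃ C : ℝ, 0 ≤ C ∧ ∀ q : ℝ, |q| ≤ 1 →
    (1 + q) ^ N ≤ 1 + N * q + C * q ^ 2 := by
  induction N with
  | zero => exact ⟨0, le_rfl, fun q _ => by simp⟩
  | succ N ih =>
    obtain ⟨C, hC, ih⟩ := ih
    refine ⟨N + 2 * C, by positivity, fun q hq => ?_⟩
    obtain ⟨hq1, hq2⟩ := abs_le.1 hq
    have h3 := mul_le_mul_of_nonneg_right (ih q hq) (by linarith : 0 ≤ 1 + q)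
    rw [← pow_succ] at h3
    refine h3.trans ?_
    have : 0 ≤ C * q ^ 2 * (1 - q) :=
      mul_nonneg (mul_nonneg hC (sq_nonneg q)) (by linarith)
    push_cast
    nlinarith

variable {Ω : Type*} [MeasurableSpace Ω] {P : Measure Ω} [IsProbabilityMeasure P]

theorem le_integral_inv_one_sub_mul_pow {Y : Ω → ℝ} (hY : Measurable Y) {K : ℝ}
    (hYK : ∀ ω, |Y ω| ≤ K) (hY0 : ∫ ω, Y ω ∂P = 0) (N : ℕ) {C : ℝ} (hC0 : 0 ≤ C)
    (hC : ∀ y : ℝ, |y| ≤ 1 / 2 →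
      1 + N * y + N * (N + 1) / 2 * y ^ 2 - C * |y| ^ 3 ≤ (1 - y)⁻¹ ^ N)
    {t : ℝ} (ht : |t| * K ≤ 1 / 2) :
    1 + N * (N + 1) / 2 * t ^ 2 * ∫ ω, Y ω ^ 2 ∂P - C * (|t| * K) ^ 3 ≤
      ∫ ω, (1 - t * Y ω)⁻¹ ^ N ∂P := by
  have hb : ∀ ω, |t * Y ω| ≤ |t| * K := fun ω => by
    rw [abs_mul]; exact mul_le_mul_of_nonneg_left (hYK ω) (abs_nonneg t)
  have hiY : Integrable Y P := .of_bound hY.aestronglyMeasurable K (.of_forall hYK)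
  have hiY2 : Integrable (fun ω => Y ω ^ 2) P :=
    .of_bound (hY.pow_const 2).aestronglyMeasurable (K ^ 2) (.of_forall fun ω => by
      rw [norm_pow]; exact pow_le_pow_left₀ (norm_nonneg _) (hYK ω) 2)
  have hi : Integrable (fun ω => (1 - t * Y ω)⁻¹ ^ N) P := by
    refine .of_bound (((hY.const_mul t).const_sub 1).inv.pow_const N).aestronglyMeasurable
      (2 ^ N) (.of_forall fun ω => ?_)
    have h1 := (abs_le.1 ((hb ω).trans ht)).2
    have h2 : 0 < 1 - t * Y ω := by linarith
    rw [norm_pow, Real.norm_of_nonneg (inv_nonneg.2 h2.le)]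
    refine pow_le_pow_left₀ (inv_nonneg.2 h2.le) ?_ N
    rw [inv_le_comm₀ h2 two_pos]; linarith
  have hl₁ : Integrable (fun ω => 1 - C * (|t| * K) ^ 3 + N * t * Y ω) P :=
    (integrable_const _).add (hiY.const_mul _)
  have hl : Integrable (fun ω => (1 - C * (|t| * K) ^ 3 + N * t * Y ω) +
      N * (N + 1) / 2 * t ^ 2 * Y ω ^ 2) P :=
    hl₁.add (hiY2.const_mul _)
  have h1 : ∫ ω, ((1 - C * (|t| * K) ^ 3 + N * t * Y ω) +
      N * (N + 1) / 2 * t ^ 2 * Y ω ^ 2) ∂P =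
      1 + N * (N + 1) / 2 * t ^ 2 * ∫ ω, Y ω ^ 2 ∂P - C * (|t| * K) ^ 3 := by
    rw [integral_add hl₁ (hiY2.const_mul _),
      integral_add (integrable_const _) (hiY.const_mul _), integral_const_mul,
      integral_const_mul, hY0]
    simp
    ring
  rw [← h1]
  refine integral_mono hl hi fun ω => ?_
  have h2 := hC (t * Y ω) ((hb ω).trans ht)
  have h3 : C * |t * Y ω| ^ 3 ≤ C * (|t| * K) ^ 3 :=
    mul_le_mul_of_nonneg_left (pow_le_pow_left₀ (abs_nonneg _) (hb ω) 3) hC0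
  dsimp only
  nlinarith

theorem integral_one_add_mul_pow_le {Q : Ω → ℝ} (hQ : Measurable Q) {K : ℝ}
    (hQK : ∀ ω, |Q ω| ≤ K) (N : ℕ) {C : ℝ} (hC0 : 0 ≤ C)
    (hC : ∀ q : ℝ, |q| ≤ 1 → (1 + q) ^ N ≤ 1 + N * q + C * q ^ 2)
    {t : ℝ} (ht : |t| * K ≤ 1) :
    ∫ ω, (1 + t * Q ω) ^ N ∂P ≤ 1 + N * t * ∫ ω, Q ω ∂P + C * (|t| * K) ^ 2 := by
  have hb : ∀ ω, |t * Q ω| ≤ |t| * K := fun ω => by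
    rw [abs_mul]; exact mul_le_mul_of_nonneg_left (hQK ω) (abs_nonneg t)
  have hiQ : Integrable Q P := .of_bound hQ.aestronglyMeasurable K (.of_forall hQK)
  have hi : Integrable (fun ω => (1 + t * Q ω) ^ N) P := by
    refine .of_bound (((hQ.const_mul t).const_add 1).pow_const N).aestronglyMeasurable
      (2 ^ N) (.of_forall fun ω => ?_)
    have h1 := abs_le.1 ((hb ω).trans ht)
    rw [norm_pow]
    refine pow_le_pow_left₀ (norm_nonneg _) ?_ N
    rw [Real.norm_eq_abs, abs_le]
    constructor <;> linarith
  have h1 : ∫ ω, ((1 + C * (|t| * K) ^ 2) + N * t * Q ω) ∂P =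
      1 + N * t * ∫ ω, Q ω ∂P + C * (|t| * K) ^ 2 := by
    rw [integral_add (integrable_const _) (hiQ.const_mul _), integral_const_mul]
    simp
    ring
  rw [← h1]
  refine integral_mono hi ((integrable_const _).add (hiQ.const_mul _)) fun ω => ?_
  have h2 := hC (t * Q ω) ((hb ω).trans ht)
  have h3 : C * (t * Q ω) ^ 2 ≤ C * (|t| * K) ^ 2 := by
    refine mul_le_mul_of_nonneg_left ?_ hC0
    rw [← sq_abs]
    exact pow_le_pow_left₀ (abs_nonneg _) (hb ω) 2
  dsimp only
  nlinarith

/-- Second-order comparison of the two sides of a Brunn–Minkowski type inequality. -/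
theorem integral_sq_le_of_eventually_mul_le_sq {Y Q : Ω → ℝ} (hY : Measurable Y)
    (hQ : Measurable Q) {K : ℝ} (hYK : ∀ ω, |Y ω| ≤ K) (hQK : ∀ ω, |Q ω| ≤ K)
    (hY0 : ∫ ω, Y ω ∂P = 0) {N : ℕ} (hN : N ≠ 0)
    (h : ∀ᶠ t in nhds (0 : ℝ), (∫ ω, (1 - t * Y ω)⁻¹ ^ N ∂P) * (∫ ω, (1 + t * Y ω)⁻¹ ^ N ∂P) ≤
      (∫ ω, (1 + t ^ 2 * Q ω) ^ N ∂P) ^ 2) :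
    (N + 1) / 2 * ∫ ω, Y ω ^ 2 ∂P ≤ ∫ ω, Q ω ∂P := by
  obtain ⟨C₁, hC₁, h₁⟩ := exists_le_inv_one_sub_pow N
  obtain ⟨C₂, hC₂, h₂⟩ := exists_one_add_pow_le N
  have hne : Nonempty Ω := P.nonempty_of_neZero
  have hK : 0 ≤ K := (abs_nonneg _).trans (hYK hne.some)
  set V := ∫ ω, Y ω ^ 2 ∂P
  set q := ∫ ω, Q ω ∂P
  have hV : 0 ≤ V := integral_nonneg fun ω => sq_nonneg _
  have hN0 : (0 : ℝ) < N := by exact_mod_cast Nat.pos_of_ne_zero hN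
  have hlim : ∀ f : ℝ → ℝ, Continuous f → f 0 = 0 → ∀ δ > 0, ∀ᶠ t in nhdsWithin (0 : ℝ) (Set.Ioi 0),
      f t < δ := fun f hf h0 δ hδ =>
    ((hf.tendsto' 0 0 h0).eventually_lt_const hδ).filter_mono nhdsWithin_le_nhds
  have hmain : ∀ᶠ t in nhdsWithin (0 : ℝ) (Set.Ioi 0),
      N * ((N + 1) / 2 * V) ≤ N * q + (C₁ * t * K ^ 3 + C₂ * t ^ 2 * K ^ 2) := by
    filter_upwards [h.filter_mono nhdsWithin_le_nhds, self_mem_nhdsWithin,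
      hlim (fun t => |t| * K) (by fun_prop) (by simp) (1 / 2) (by norm_num),
      hlim (fun t => |t ^ 2| * K) (by fun_prop) (by simp) 1 (by norm_num),
      hlim (fun t => C₁ * (|t| * K) ^ 3) (by fun_prop) (by simp) 1 (by norm_num)]
      with t ht ht0 htK htK2 htC
    have ht0 : 0 < t := ht0
    have e1 := le_integral_inv_one_sub_mul_pow hY hYK hY0 N hC₁ h₁ htK.le
    have e2 := le_integral_inv_one_sub_mul_pow (t := -t) hY hYK hY0 N hC₁ h₁
      (by rw [abs_neg]; exact htK.le)
    have e3 := integral_one_add_mul_pow_le (P := P) hQ hQK N hC₂ h₂ htK2.le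
    simp only [neg_mul, sub_neg_eq_add, abs_neg, neg_sq] at e2
    rw [abs_of_pos ht0] at e1 e2 htC
    rw [abs_of_pos (pow_pos ht0 2)] at e3
    set s := 1 + N * (N + 1) / 2 * t ^ 2 * V - C₁ * (t * K) ^ 3
    have hs : 0 < s := by
      have : 0 ≤ N * (N + 1) / 2 * t ^ 2 * V := by positivity
      change 0 < 1 + N * (N + 1) / 2 * t ^ 2 * V - C₁ * (t * K) ^ 3
      linarith
    have e4 : s ^ 2 ≤ (∫ ω, (1 + t ^ 2 * Q ω) ^ N ∂P) ^ 2 :=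
      le_trans (by nlinarith) ht
    have hnn : 0 ≤ ∫ ω, (1 + t ^ 2 * Q ω) ^ N ∂P := by
      refine integral_nonneg fun ω => pow_nonneg ?_ N
      have := mul_le_mul_of_nonneg_left (hQK ω) (sq_nonneg t)
      have h5 := neg_abs_le (Q ω)
      rw [abs_of_pos (pow_pos ht0 2)] at htK2
      nlinarith [sq_nonneg t]
    have e5 := (pow_le_pow_iff_left₀ hs.le hnn two_ne_zero).1 e4
    have e6 := e5.trans e3
    have ht2 : 0 < t ^ 2 := pow_pos ht0 2
    refine le_of_mul_le_mul_left ?_ ht2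
    change 1 + N * (N + 1) / 2 * t ^ 2 * V - C₁ * (t * K) ^ 3 ≤ _ at e6
    linear_combination e6
  have hcont : Continuous fun t : ℝ => N * q + (C₁ * t * K ^ 3 + C₂ * t ^ 2 * K ^ 2) := by
    fun_prop
  have hfin : N * ((N + 1) / 2 * V) ≤ N * q := by
    have := ge_of_tendsto ((hcont.tendsto 0).mono_left nhdsWithin_le_nhds) hmain
    simpa using this
  exact le_of_mul_le_mul_left hfin hN0

end Moments

section SphereMean

variable {n : ℕ}

/-- The rotation-invariant probability measure on the unit sphere. -/
def sphereProb (n : ℕ) : Measure (sphere (0 : E n) 1) :=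
  ((volume : Measure (E n)).toSphere Set.univ)⁻¹ • (volume : Measure (E n)).toSphere

theorem toSphere_univ_ne_zero : (volume : Measure (E n)).toSphere Set.univ ≠ 0 :=
  Measure.measure_univ_ne_zero.2 (Measure.toSphere_ne_zero _)

instance : IsProbabilityMeasure (sphereProb n) :=
  ⟨by simpa [sphereProb] using
    ENNReal.inv_mul_cancel toSphere_univ_ne_zero (measure_ne_top _ _)⟩

theorem toSphere_eq_smul_sphereProb : (volume : Measure (E n)).toSphere =
    (volume : Measure (E n)).toSphere Set.univ • sphereProb n := by
  rw [sphereProb, smul_smul, ENNReal.mul_inv_cancel toSphere_univ_ne_zero (measure_ne_top _ _),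
    one_smul]

theorem volume_starRegion_eq_mul {r : E n → ℝ} (hr : Measurable r)
    (hpos : ∀ x ∈ sphere (0 : E n) 1, 0 < r x) {K : ℝ} (hK : ∀ x ∈ sphere (0 : E n) 1, r x ≤ K) :
    volume (starRegion r) = (volume : Measure (E n)).toSphere Set.univ *
      ENNReal.ofReal (((n : ℝ) + 1)⁻¹) *
      ENNReal.ofReal (∫ u : sphere (0 : E n) 1, r u ^ (n + 1) ∂sphereProb n) := by
  have hn : (0 : ℝ) ≤ ((n : ℝ) + 1)⁻¹ := by positivity
  have hm : Measurable fun u : sphere (0 : E n) 1 => r u ^ (n + 1) :=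
    (hr.comp measurable_subtype_coe).pow_const _
  rw [volume_starRegion hr hpos, toSphere_eq_smul_sphereProb, lintegral_smul_measure, smul_eq_mul,
    ofReal_integral_eq_lintegral_ofReal, mul_assoc, ← lintegral_const_mul _ hm.ennreal_ofReal]
  · simp only [← ENNReal.ofReal_mul hn, measure_univ, Measure.smul_apply, smul_eq_mul, mul_one]
    simp only [div_eq_inv_mul]
  · refine .of_bound hm.aestronglyMeasurable (K ^ (n + 1)) (.of_forall fun u => ?_)
    have h1 := hpos u u.2
    rw [norm_pow, Real.norm_of_nonneg h1.le]
    exact pow_le_pow_left₀ h1.le (hK u u.2) _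
  · exact .of_forall fun u => pow_nonneg (hpos u u.2).le _

theorem exists_abs_le_of_continuousAt {f : E n → ℝ} (hf : ∀ x : E n, x ≠ 0 → ContinuousAt f x) :
    ∃ K, 0 ≤ K ∧ ∀ x ∈ sphere (0 : E n) 1, |f x| ≤ K := by
  obtain ⟨K, hK⟩ := (isCompact_sphere (0 : E n) 1).exists_bound_of_continuousOn
    fun x hx => (hf x (ne_of_mem_sphere hx one_ne_zero)).continuousWithinAt
  exact ⟨max K 0, le_max_right _ _, fun x hx => (hK x hx).trans (le_max_left _ _)⟩

theorem integrable_sphereProb {f : E n → ℝ} (hf : ∀ x : E n, x ≠ 0 → ContinuousAt f x) :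
    Integrable (fun u : sphere (0 : E n) 1 => f u) (sphereProb n) :=
  (continuous_iff_continuousAt.2 fun u : sphere (0 : E n) 1 =>
    (hf u (ne_of_mem_sphere u.2 one_ne_zero)).comp_of_eq continuous_subtype_val.continuousAt
      rfl).integrable_of_hasCompactSupport (.of_compactSpace _)

variable {H : E n → ℝ}

namespace IsSelfSimilarSupport

theorem integral_sq_centredComponent_le (h : IsSelfSimilarSupport H) (e : E n) {m : ℝ}
    (hm : ∫ u : sphere (0 : E n) 1, ⟪gradient H u, e⟫ ∂sphereProb n = m) :
    n * ∫ u : sphere (0 : E n) 1, centredComponent H e m u ^ 2 ∂sphereProb n ≤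
      ∫ u : sphere (0 : E n) 1, H u * ⟪hess H u e, e⟫ ∂sphereProb n := by
  set P := sphereProb n
  have hcY := fun x (hx : x ≠ 0) => h.continuousAt_centredComponent e m hx
  have hcq : ∀ x : E n, x ≠ 0 → ContinuousAt (fun x => H x * ⟪hess H x e, e⟫) x := fun x hx =>
    (h.continuousAt hx).mul (((h.continuousAt_hess hx).clm_apply continuousAt_const).inner
      continuousAt_const)
  have hiX : Integrable (fun u : sphere (0 : E n) 1 => ⟪gradient H u, e⟫) P :=
    integrable_sphereProb fun x hx => (h.continuousAt_gradient hx).inner continuousAt_const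
  have hY0 : ∫ u : sphere (0 : E n) 1, centredComponent H e m u ∂P = 0 := by
    simp only [centredComponent]
    rw [integral_sub hiX (integrable_const _), hm]
    simp
  have key : ∀ ε > 0, ((n + 1 : ℕ) + 1) / 2 *
      ∫ u : sphere (0 : E n) 1, centredComponent H e m u ^ 2 ∂P ≤
      ∫ u : sphere (0 : E n) 1, secondOrderCoeff H e m ε u ∂P := by
    intro ε hε
    obtain ⟨K₁, hK₁, hY⟩ := exists_abs_le_of_continuousAt hcY
    obtain ⟨K₂, hK₂, hQ⟩ := exists_abs_le_of_continuousAt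
      fun x (hx : x ≠ 0) => h.continuousAt_secondOrderCoeff e m ε hx
    have hYm : Measurable (centredComponent H e m) := measurable_centredComponent e m
    have hQm : Measurable (secondOrderCoeff H e m ε) := h.measurable_secondOrderCoeff e m ε
    refine integral_sq_le_of_eventually_mul_le_sq (P := P) (K := max K₁ K₂)
      (Y := fun u : sphere (0 : E n) 1 => centredComponent H e m u)
      (Q := fun u : sphere (0 : E n) 1 => secondOrderCoeff H e m ε u)
      (hYm.comp measurable_subtype_coe) (hQm.comp measurable_subtype_coe)
      (fun u => (hY u u.2).trans (le_max_left _ _)) (fun u => (hQ u u.2).trans (le_max_right _ _))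
      hY0 n.succ_ne_zero ?_
    have hsmall : ∀ (k : ℕ) (K : ℝ), k ≠ 0 → ∀ᶠ t in nhds (0 : ℝ), |t ^ k| * K < 1 / 2 := by
      intro k K hk
      have : Continuous fun t : ℝ => |t ^ k| * K := by fun_prop
      exact (this.tendsto' 0 0 (by simp [hk])).eventually_lt_const (by norm_num)
    filter_upwards [h.eventually_volume_mul_volume_le e m hε, hsmall 1 K₁ one_ne_zero,
      hsmall 2 K₂ two_ne_zero] with t ht ht1 ht2
    rw [pow_one] at ht1
    have hb : ∀ x ∈ sphere (0 : E n) 1, |t * centredComponent H e m x| < 1 / 2 := fun x hx => by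
      rw [abs_mul]; exact (mul_le_mul_of_nonneg_left (hY x hx) (abs_nonneg t)).trans_lt ht1
    have hb2 : ∀ x ∈ sphere (0 : E n) 1, |t ^ 2 * secondOrderCoeff H e m ε x| < 1 / 2 :=
      fun x hx => by
        rw [abs_mul]; exact (mul_le_mul_of_nonneg_left (hQ x hx) (abs_nonneg _)).trans_lt ht2
    have hinv : ∀ y : ℝ, 1 / 2 < y → 0 < y⁻¹ ∧ y⁻¹ ≤ 2 := fun y hy =>
      ⟨inv_pos.2 (by linarith), by rw [inv_le_comm₀ (by linarith) two_pos]; linarith⟩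
    have h1 : ∀ x ∈ sphere (0 : E n) 1, 0 < (1 - t * centredComponent H e m x)⁻¹ ∧
        (1 - t * centredComponent H e m x)⁻¹ ≤ 2 := fun x hx =>
      hinv _ (by linarith [(abs_lt.1 (hb x hx)).2])
    have h2 : ∀ x ∈ sphere (0 : E n) 1, 0 < (1 + t * centredComponent H e m x)⁻¹ ∧
        (1 + t * centredComponent H e m x)⁻¹ ≤ 2 := fun x hx =>
      hinv _ (by linarith [(abs_lt.1 (hb x hx)).1])
    rw [volume_starRegion_eq_mul (r := fun x => (1 - t * centredComponent H e m x)⁻¹)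
        ((hYm.const_mul t).const_sub 1).inv (fun x hx => (h1 x hx).1)
        fun x hx => (h1 x hx).2,
      volume_starRegion_eq_mul (r := fun x => (1 + t * centredComponent H e m x)⁻¹)
        ((hYm.const_mul t).const_add 1).inv (fun x hx => (h2 x hx).1)
        fun x hx => (h2 x hx).2,
      volume_starRegion_eq_mul (K := 2) (r := fun x => 1 + t ^ 2 * secondOrderCoeff H e m ε x)
        ((hQm.const_mul (t ^ 2)).const_add 1)
        (fun x hx => by linarith [(abs_lt.1 (hb2 x hx)).1])
        fun x hx => by linarith [(abs_lt.1 (hb2 x hx)).2]] at ht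
    set c := (volume : Measure (E n)).toSphere Set.univ * ENNReal.ofReal (((n : ℝ) + 1)⁻¹)
    have hc0 : c ≠ 0 := mul_ne_zero toSphere_univ_ne_zero (by simp; positivity)
    have hc1 : c ≠ ⊤ := ENNReal.mul_ne_top (measure_ne_top _ _) ENNReal.ofReal_ne_top
    have ha : 0 ≤ ∫ u : sphere (0 : E n) 1, (1 - t * centredComponent H e m u)⁻¹ ^ (n + 1) ∂P :=
      integral_nonneg fun u => pow_nonneg (h1 u u.2).1.le _
    have hd : 0 ≤ ∫ u : sphere (0 : E n) 1, (1 + t ^ 2 * secondOrderCoeff H e m ε u) ^ (n + 1) ∂P :=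
      integral_nonneg fun u => pow_nonneg (by linarith [(abs_lt.1 (hb2 u u.2)).1]) _
    rw [mul_mul_mul_comm, mul_pow, ← sq,
      ENNReal.mul_le_mul_iff_right (pow_ne_zero 2 hc0) (ENNReal.pow_ne_top hc1),
      ← ENNReal.ofReal_mul ha, ← ENNReal.ofReal_pow hd,
      ENNReal.ofReal_le_ofReal_iff (pow_nonneg hd 2)] at ht
    exact ht
  have hQint : ∀ ε, ∫ u : sphere (0 : E n) 1, secondOrderCoeff H e m ε u ∂P =
      ∫ u : sphere (0 : E n) 1, centredComponent H e m u ^ 2 ∂P +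
        (∫ u : sphere (0 : E n) 1, H u * ⟪hess H u e, e⟫ ∂P) / 2 + ε := by
    intro ε
    have hi1 : Integrable (fun u : sphere (0 : E n) 1 => centredComponent H e m u ^ 2) P :=
      integrable_sphereProb (f := fun x => centredComponent H e m x ^ 2)
        fun x hx => (hcY x hx).pow 2
    have hi2 : Integrable (fun u : sphere (0 : E n) 1 => H u * ⟪hess H u e, e⟫ / 2) P :=
      (integrable_sphereProb hcq).div_const 2
    have hi3 : Integrable (fun u : sphere (0 : E n) 1 => centredComponent H e m u ^ 2 +
      H u * ⟪hess H u e, e⟫ / 2) P := hi1.add hi2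
    simp only [secondOrderCoeff]
    rw [integral_add hi3 (integrable_const _), integral_add hi1 hi2, integral_div]
    simp
  set V := ∫ u : sphere (0 : E n) 1, centredComponent H e m u ^ 2 ∂P
  set q := ∫ u : sphere (0 : E n) 1, H u * ⟪hess H u e, e⟫ ∂P
  have hfin : ((n + 1 : ℕ) + 1) / 2 * V ≤ V + q / 2 :=
    le_of_forall_pos_le_add fun ε hε => by rw [← hQint]; exact key ε hε
  push_cast at hfin
  linarith

end IsSelfSimilarSupport

end SphereMean

section SphereDivergence

variable {n : ℕ}

theorem integral_mul_radial {φ : E n → ℝ} {ψ : ℝ → ℝ} {k : ℕ}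
    (hφ : ∀ r : ℝ, 0 < r → ∀ u ∈ sphere (0 : E n) 1, φ (r • u) = r ^ k * φ u) :
    ∫ x, φ x * ψ ‖x‖ = (∫ u : sphere (0 : E n) 1, φ u ∂(volume : Measure (E n)).toSphere) *
      ∫ r in Set.Ioi (0 : ℝ), r ^ n * (r ^ k * ψ r) := by
  have hmp := MeasurePreserving.symm (homeomorphUnitSphereProd (E n)).toMeasurableEquiv
    (Measure.measurePreserving_homeomorphUnitSphereProd (volume : Measure (E n)))
  have hdim : Module.finrank ℝ (E n) - 1 = n := by simp
  rw [hdim] at hmp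
  have h1 : ∫ x, φ x * ψ ‖x‖ = ∫ x : ({(0)}ᶜ : Set (E n)), φ x.1 * ψ ‖x.1‖
      ∂((volume : Measure (E n)).comap (↑)) := by
    rw [integral_subtype_comap (measurableSet_singleton _).compl fun x => φ x * ψ ‖x‖,
      restrict_compl_singleton]
  have h2 := hmp.integral_comp (MeasurableEquiv.measurableEmbedding _)
    (fun x : ({(0)}ᶜ : Set (E n)) => φ x.1 * ψ ‖x.1‖)
  rw [h1, ← h2]
  have h3 : ∀ p : sphere (0 : E n) 1 × Set.Ioi (0 : ℝ),
      φ ((homeomorphUnitSphereProd (E n)).toMeasurableEquiv.symm p).1 *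
        ψ ‖((homeomorphUnitSphereProd (E n)).toMeasurableEquiv.symm p).1‖ =
      φ p.1 * ((p.2 : ℝ) ^ k * ψ p.2) := by
    rintro ⟨u, r, hr⟩
    have hr0 : 0 < r := hr
    have hu : ‖(u : E n)‖ = 1 := by simp
    have h4 : ((homeomorphUnitSphereProd (E n)).toMeasurableEquiv.symm (u, ⟨r, hr⟩)).1 =
      r • (u : E n) := by simp
    rw [h4, hφ r hr0 u u.2, norm_smul, hu, Real.norm_of_nonneg hr0.le, mul_one]
    ring
  simp_rw [h3]
  rw [integral_prod_mul (fun u : sphere (0 : E n) 1 => φ u)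
    fun r : Set.Ioi (0 : ℝ) => (r : ℝ) ^ k * ψ r]
  congr 1
  simp only [Measure.volumeIoiPow, ENNReal.ofReal]
  rw [integral_withDensity_eq_integral_smul (measurable_subtype_coe.pow_const _).real_toNNReal,
    integral_subtype_comap measurableSet_Ioi
      fun a => Real.toNNReal (a ^ n) • (a ^ k * ψ a),
    setIntegral_congr_fun measurableSet_Ioi fun x hx => ?_]
  rw [NNReal.smul_def, Real.coe_toNNReal _ (pow_nonneg (Set.mem_Ioi.1 hx).le _), smul_eq_mul]

theorem integrable_mul_radial {φ : E n → ℝ} (hφ : ∀ x, x ≠ 0 → ContinuousAt φ x) {ψ : ℝ → ℝ}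
    (hψ : Continuous ψ) {a b : ℝ} (ha : 0 < a) (hψ0 : ∀ r, r < a ∨ b < r → ψ r = 0) :
    Integrable fun x => φ x * ψ ‖x‖ := by
  refine Continuous.integrable_of_hasCompactSupport (continuous_iff_continuousAt.2 fun x => ?_) ?_
  · rcases eq_or_ne x 0 with rfl | hx
    · refine ContinuousAt.congr (f := fun _ => 0) continuousAt_const ?_
      filter_upwards [ball_mem_nhds (0 : E n) ha] with y hy
      rw [hψ0 _ (Or.inl (by simpa using hy)), mul_zero]
    · exact (hφ x hx).mul (hψ.comp continuous_norm).continuousAt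
  · refine HasCompactSupport.intro (isCompact_closedBall (0 : E n) b) fun x hx => ?_
    rw [hψ0 _ (Or.inr (by simpa using hx)), mul_zero]

/-- The divergence theorem on the unit ball for a `1`-homogeneous function `f`, integrated
against a constant vector and expressed on the sphere. -/
theorem integral_fderiv_apply_eq {f : E n → ℝ} {f' : E n → E n →L[ℝ] ℝ}
    (hf : ∀ x, x ≠ 0 → HasFDerivAt f (f' x) x) (hf' : ∀ x, x ≠ 0 → ContinuousAt f' x)
    (hhom : ∀ (t : ℝ) (x : E n), 0 < t → f (t • x) = t * f x) (e : E n) :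
    ∫ u : sphere (0 : E n) 1, f' u e ∂sphereProb n =
      (n + 1) * ∫ u : sphere (0 : E n) 1, f u * ⟪(u : E n), e⟫ ∂sphereProb n := by
  have hf'hom : ∀ r : ℝ, 0 < r → ∀ x : E n, x ≠ 0 → f' (r • x) = f' x := by
    intro r hr x hx
    have h1 : HasFDerivAt (fun y => f (r • y)) ((f' (r • x)).comp
        (r • ContinuousLinearMap.id ℝ (E n))) x :=
      (hf _ (smul_ne_zero hr.ne' hx)).comp x ((hasFDerivAt_id x).const_smul r)
    have h2 : HasFDerivAt (fun y => f (r • y)) (r • f' x) x := by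
      simp_rw [hhom r _ hr]
      exact (hf x hx).const_mul r
    ext v
    have h3 := congrArg (fun L : E n →L[ℝ] ℝ => L v) (h1.unique h2)
    simpa [hr.ne'] using h3
  let w : ContDiffBump (2 : ℝ) := ⟨1 / 2, 1, by norm_num, by norm_num⟩
  have hw0 : ∀ r, r < 1 ∨ 3 < r → w r = 0 := by
    intro r hr
    refine w.zero_of_le_dist ?_
    rw [Real.dist_eq, le_abs]
    change 1 ≤ _ ∨ 1 ≤ _
    rcases hr with hr | hr
    · right; linarith
    · left; linarith
  have hwd : Differentiable ℝ w := (w.contDiff (n := 1)).differentiable (by simp)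
  have hw'c : Continuous (deriv w) := (w.contDiff (n := 1)).continuous_deriv le_rfl
  have hw'0 : ∀ r, r < 1 ∨ 3 < r → deriv w r = 0 := by
    intro r hr
    have hO : IsOpen {r : ℝ | r < 1 ∨ 3 < r} := isOpen_Iio.union isOpen_Ioi
    have h0 : (w : ℝ → ℝ) =ᶠ[nhds r] fun _ => 0 := by
      filter_upwards [hO.mem_nhds hr] with s hs using hw0 s hs
    rw [h0.deriv_eq, deriv_const]
  set I : ℝ := ∫ r in Set.Ioi (0 : ℝ), r ^ n * w r with hI
  have hI0 : I ≠ 0 := by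
    have hcont : Continuous fun r : ℝ => r ^ n * w r := by
      have := w.continuous
      fun_prop
    have h1 : I = ∫ r : ℝ, r ^ n * w r :=
      setIntegral_eq_integral_of_forall_compl_eq_zero fun r hr => by
        rw [hw0 r (Or.inl ((not_lt.1 hr).trans_lt one_pos)), mul_zero]
    rw [h1]
    refine (hcont.integral_pos_of_hasCompactSupport_nonneg_nonzero (w.hasCompactSupport.mul_left)
      (fun r => ?_) (x := 2) ?_).ne'
    · rcases lt_or_ge r 1 with hr | hr
      · simp [hw0 r (Or.inl hr)]
      · exact mul_nonneg (pow_nonneg (by linarith) _) w.nonneg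
    · exact mul_ne_zero (by positivity)
        (w.pos_of_mem_ball (mem_ball_self w.rOut_pos)).ne'
  have hI' : ∫ r in Set.Ioi (0 : ℝ), r ^ n * (r ^ 1 * deriv w r) = -((n + 1) * I) := by
    have hd : ∀ r : ℝ, HasDerivAt (fun r => r ^ (n + 1) * w r)
        ((n + 1) * (r ^ n * w r) + r ^ n * (r ^ 1 * deriv w r)) r := by
      intro r
      convert! (hasDerivAt_pow (n + 1) r).mul (hwd r).hasDerivAt using 1
      simp
      ring
    have hi1 : Integrable fun r : ℝ => r ^ n * w r :=
      Continuous.integrable_of_hasCompactSupport ((continuous_pow n).mul w.continuous)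
        w.hasCompactSupport.mul_left
    have hi2 : Integrable fun r : ℝ => r ^ n * (r ^ 1 * deriv w r) :=
      Continuous.integrable_of_hasCompactSupport ((continuous_pow n).mul
        ((continuous_pow 1).mul hw'c)) w.hasCompactSupport.deriv.mul_left.mul_left
    have h1 := integral_Ioi_of_hasDerivAt_of_tendsto (a := 0) (m := 0)
      (hd 0).continuousAt.continuousWithinAt (fun r _ => hd r)
      ((hi1.const_mul _).add hi2).integrableOn
      (tendsto_const_nhds.congr' (by
        filter_upwards [Filter.eventually_gt_atTop 3] with r hr
        rw [hw0 r (Or.inr hr), mul_zero]))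
    rw [integral_add (hi1.const_mul _).integrableOn hi2.integrableOn, integral_const_mul] at h1
    simp only [ne_eq, Nat.add_eq_zero_iff, one_ne_zero, and_false, not_false_eq_true, zero_pow,
      zero_mul, sub_zero] at h1
    linarith
  have hg : ∀ x : E n, HasFDerivAt (fun x => w ‖x‖)
      (deriv w ‖x‖ • (‖x‖⁻¹ • innerSL ℝ x)) x := by
    intro x
    rcases eq_or_ne x 0 with rfl | hx
    · rw [norm_zero, hw'0 0 (Or.inl one_pos), zero_smul]
      refine (hasFDerivAt_const (0 : ℝ) (0 : E n)).congr_of_eventuallyEq ?_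
      filter_upwards [ball_mem_nhds (0 : E n) one_pos] with y hy
      exact hw0 _ (Or.inl (by simpa using hy))
    · exact (hwd ‖x‖).hasDerivAt.comp_hasFDerivAt x (hasFDerivAt_norm' hx)
  have hc1 : ∀ x, x ≠ 0 → ContinuousAt (fun x => f' x e) x := fun x hx =>
    (hf' x hx).clm_apply continuousAt_const
  have hc2 : ∀ x, x ≠ 0 → ContinuousAt (fun x => f x * (‖x‖⁻¹ * ⟪x, e⟫)) x := fun x hx =>
    (hf x hx).continuousAt.mul ((continuous_norm.continuousAt.inv₀ (norm_ne_zero_iff.2 hx)).mul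
      (by fun_prop))
  have hi1 : Integrable fun x => f' x e * w ‖x‖ :=
    integrable_mul_radial hc1 w.continuous one_pos hw0
  have hi2 : Integrable fun x => f x * w ‖x‖ :=
    integrable_mul_radial (fun x hx => (hf x hx).continuousAt) w.continuous one_pos hw0
  have hi3 : Integrable fun x => f x * (‖x‖⁻¹ * ⟪x, e⟫) * deriv w ‖x‖ :=
    integrable_mul_radial hc2 hw'c one_pos hw'0
  have hts : ∀ x ∈ tsupport fun x : E n => w ‖x‖, x ≠ 0 := by
    rintro x hx rfl
    have : tsupport (fun x : E n => w ‖x‖) ⊆ {x | 1 ≤ ‖x‖} := by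
      refine closure_minimal (fun y hy => ?_) (isClosed_le continuous_const continuous_norm)
      by_contra hlt
      exact hy (hw0 _ (Or.inl (not_le.1 hlt)))
    have h1 := this hx
    norm_num at h1
  have hparts := integral_bilinear_hasFDerivAt_right_eq_neg_left_of_integrable
    (μ := (volume : Measure (E n))) (B := ContinuousLinearMap.mul ℝ ℝ) (v := e) (f := f) (f' := f')
    (g := fun x => w ‖x‖) hi1
    (hi3.congr (.of_forall fun x => by simp; ring)) hi2 (fun x hx => hf x (hts x hx))
    fun x _ => hg x
  have hl : ∫ x, ContinuousLinearMap.mul ℝ ℝ (f x) ((deriv w ‖x‖ • (‖x‖⁻¹ • innerSL ℝ x)) e) =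
      ∫ x, f x * (‖x‖⁻¹ * ⟪x, e⟫) * deriv w ‖x‖ :=
    integral_congr_ae (.of_forall fun x => by simp; ring)
  rw [hl] at hparts
  have h3 := integral_mul_radial (k := 0) (φ := fun x => f' x e) (ψ := w)
    fun r hr u hu => by
      rw [hf'hom r hr u (ne_of_mem_sphere hu one_ne_zero), pow_zero, one_mul]
  have h4 := integral_mul_radial (k := 1) (φ := fun x => f x * (‖x‖⁻¹ * ⟪x, e⟫)) (ψ := deriv w)
    fun r hr u hu => by
      rw [hhom r u hr, norm_smul, Real.norm_of_nonneg hr.le, real_inner_smul_left]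
      field_simp
  simp only [pow_zero, one_mul] at h3
  rw [← hI] at h3
  rw [hI'] at h4
  have hr : ∫ x, ContinuousLinearMap.mul ℝ ℝ (f' x e) (w ‖x‖) = ∫ x, f' x e * w ‖x‖ := rfl
  rw [hr, h3, h4] at hparts
  have hnorm : ∫ u : sphere (0 : E n) 1, f u * (‖(u : E n)‖⁻¹ * ⟪(u : E n), e⟫)
      ∂(volume : Measure (E n)).toSphere =
      ∫ u : sphere (0 : E n) 1, f u * ⟪(u : E n), e⟫ ∂(volume : Measure (E n)).toSphere := by
    simp
  rw [hnorm] at hparts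
  have h5 : ∫ u : sphere (0 : E n) 1, f' u e ∂(volume : Measure (E n)).toSphere = (n + 1) *
      ∫ u : sphere (0 : E n) 1, f u * ⟪(u : E n), e⟫ ∂(volume : Measure (E n)).toSphere := by
    refine mul_right_cancel₀ hI0 ?_
    linear_combination hparts
  rw [sphereProb, integral_smul_measure, integral_smul_measure, h5, smul_eq_mul, smul_eq_mul]
  ring

end SphereDivergence

section Rigidity

variable {n : ℕ} {H : E n → ℝ}

instance : (sphereProb n).IsOpenPosMeasure :=
  Measure.isOpenPosMeasure_smul _ (ENNReal.inv_ne_zero.2 (measure_ne_top _ _))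

theorem sq_inner_integral_eq (a : E n) :
    ‖a‖ ^ 2 = (n + 1) * ∫ u : sphere (0 : E n) 1, ⟪(u : E n), a⟫ ^ 2 ∂sphereProb n := by
  have h1 := integral_fderiv_apply_eq (f := fun x : E n => ⟪x, a⟫)
    (f' := fun _ => innerSL ℝ a) (fun x _ => by
      simp_rw [real_inner_comm]
      exact (innerSL ℝ a).hasFDerivAt) (fun x _ => continuousAt_const)
    (fun t x _ => real_inner_smul_left x a t) a
  simpa [sq] using h1

/-- The mean of `∇H` over the unit sphere. -/
def gradientMean (H : E n → ℝ) : E n := ∫ u : sphere (0 : E n) 1, gradient H u ∂sphereProb n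

namespace IsSelfSimilarSupport

theorem integrable_gradient (h : IsSelfSimilarSupport H) :
    Integrable (fun u : sphere (0 : E n) 1 => gradient H u) (sphereProb n) :=
  (continuous_iff_continuousAt.2 fun u : sphere (0 : E n) 1 =>
    (h.continuousAt_gradient (ne_of_mem_sphere u.2 one_ne_zero)).comp_of_eq
      continuous_subtype_val.continuousAt rfl).integrable_of_hasCompactSupport (.of_compactSpace _)

theorem integral_inner_gradient (h : IsSelfSimilarSupport H) (e : E n) :
    ∫ u : sphere (0 : E n) 1, ⟪gradient H u, e⟫ ∂sphereProb n = ⟪gradientMean H, e⟫ := by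
  rw [real_inner_comm, gradientMean, ← integral_inner h.integrable_gradient]
  simp_rw [real_inner_comm]

theorem inner_integral_gradient (h : IsSelfSimilarSupport H) (e : E n) :
    ⟪gradientMean H, e⟫ =
      (n + 1) * ∫ u : sphere (0 : E n) 1, H u * ⟪(u : E n), e⟫ ∂sphereProb n := by
  rw [← h.integral_inner_gradient, ← integral_fderiv_apply_eq (f := H) (f' := fderiv ℝ H)
    (fun x hx => ?_) (fun x hx => ?_) h.hom e]
  · simp
  · exact (hasGradientAt_of_contDiffOn h.smooth hx).differentiableAt.hasFDerivAt
  · have := h.continuousAt_gradient hx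
    exact ((InnerProductSpace.toDual ℝ (E n)).continuous.continuousAt.comp this).congr
      (.of_forall fun y => by simp [gradient])

theorem integral_sq_inner_gradient_add (h : IsSelfSimilarSupport H) (e : E n) :
    ∫ u : sphere (0 : E n) 1, ⟪gradient H u, e⟫ ^ 2 ∂sphereProb n +
      ∫ u : sphere (0 : E n) 1, H u * ⟪hess H u e, e⟫ ∂sphereProb n =
    (n + 1) * ∫ u : sphere (0 : E n) 1, H u * (⟪gradient H u, e⟫ * ⟪(u : E n), e⟫)
      ∂sphereProb n := by
  have h1 := integral_fderiv_apply_eq (f := fun x => H x * ⟪gradient H x, e⟫)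
    (f' := fun x => H x • (innerSL ℝ e ∘L hess H x) + ⟪gradient H x, e⟫ • innerSL ℝ (gradient H x))
    (fun x hx => ?_) (fun x hx => ?_) (fun t x ht => ?_) e
  · rw [← integral_add
      (integrable_sphereProb (f := fun x => ⟪gradient H x, e⟫ ^ 2) fun x hx =>
        ((h.continuousAt_gradient hx).inner continuousAt_const).pow 2)
      (integrable_sphereProb (f := fun x => H x * ⟪hess H x e, e⟫) fun x hx =>
        (h.continuousAt hx).mul (((h.continuousAt_hess hx).clm_apply continuousAt_const).inner
          continuousAt_const))]
    simp_rw [mul_assoc] at h1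
    rw [← h1]
    refine integral_congr_ae (.of_forall fun u => ?_)
    change _ = H u * ⟪e, hess H u e⟫ + ⟪gradient H u, e⟫ * ⟪gradient H u, e⟫
    simp only [real_inner_comm e]
    ring
  · have hX : HasFDerivAt (fun x => ⟪gradient H x, e⟫) (innerSL ℝ e ∘L hess H x) x := by
      simp_rw [real_inner_comm e]
      exact (innerSL ℝ e).hasFDerivAt.comp x (hasFDerivAt_gradient h.smooth hx)
    have hH := (hasGradientAt_of_contDiffOn h.smooth hx).hasFDerivAt
    exact hH.mul hX
  · have hX : ContinuousAt (fun x => ⟪gradient H x, e⟫) x :=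
      (h.continuousAt_gradient hx).inner continuousAt_const
    have hX' : ContinuousAt (fun x => innerSL ℝ (gradient H x)) x :=
      (innerSL ℝ).continuous.continuousAt.comp' (h.continuousAt_gradient hx)
    exact ((h.continuousAt hx).smul (continuousAt_const.clm_comp (h.continuousAt_hess hx))).add
      (hX.smul hX')
  · rcases eq_or_ne x 0 with rfl | hx
    · have h0 : H 0 = 0 := by
        have := h.hom 2 0 two_pos
        rw [smul_zero] at this
        linarith
      simp [h0]
    · rw [h.hom t x ht, gradient_smul_of_pos h.hom h.smooth ht hx, mul_assoc]

theorem integral_sq_inner_gradient_le (h : IsSelfSimilarSupport H) (e : E n) :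
    (n + 1) * ∫ u : sphere (0 : E n) 1, ⟪gradient H u, e⟫ ^ 2 ∂sphereProb n -
      n * ⟪gradientMean H, e⟫ ^ 2 ≤
    (n + 1) * ∫ u : sphere (0 : E n) 1, H u * (⟪gradient H u, e⟫ * ⟪(u : E n), e⟫)
      ∂sphereProb n := by
  have h1 := h.integral_sq_centredComponent_le e (h.integral_inner_gradient e)
  have h2 : ∀ m, ⟪gradientMean H, e⟫ = m →
      ∫ u : sphere (0 : E n) 1, centredComponent H e m u ^ 2 ∂sphereProb n =
      ∫ u : sphere (0 : E n) 1, ⟪gradient H u, e⟫ ^ 2 ∂sphereProb n - m ^ 2 := by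
    intro m hm
    have hi1 : Integrable (fun u : sphere (0 : E n) 1 => ⟪gradient H u, e⟫ ^ 2) (sphereProb n) :=
      integrable_sphereProb (f := fun x => ⟪gradient H x, e⟫ ^ 2) fun x hx =>
        ((h.continuousAt_gradient hx).inner continuousAt_const).pow 2
    have hi2 : Integrable (fun u : sphere (0 : E n) 1 => 2 * m * ⟪gradient H u, e⟫ - m ^ 2)
        (sphereProb n) :=
      ((h.integrable_gradient.inner_const e).const_mul (2 * m)).sub (integrable_const _)
    have h3 : ∀ u : sphere (0 : E n) 1, centredComponent H e m u ^ 2 =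
        ⟪gradient H u, e⟫ ^ 2 - (2 * m * ⟪gradient H u, e⟫ - m ^ 2) := fun u => by
      rw [centredComponent]; ring
    simp_rw [h3]
    rw [integral_sub hi1 hi2, integral_sub ((h.integrable_gradient.inner_const e).const_mul _)
      (integrable_const _), integral_const_mul, h.integral_inner_gradient, hm]
    simp
    ring
  rw [h2 _ rfl] at h1
  linarith [h.integral_sq_inner_gradient_add e]

theorem integral_norm_sq_gradient_le (h : IsSelfSimilarSupport H) :
    (n + 1) * ∫ u : sphere (0 : E n) 1, ‖gradient H u‖ ^ 2 ∂sphereProb n -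
      n * ‖gradientMean H‖ ^ 2 ≤
    (n + 1) * ∫ u : sphere (0 : E n) 1, H u ^ 2 ∂sphereProb n := by
  let b := EuclideanSpace.basisFun (Fin (n + 1)) ℝ
  have h1 := Finset.sum_le_sum fun i (_ : i ∈ Finset.univ) =>
    h.integral_sq_inner_gradient_le (b i)
  have hsq : ∀ y : E n, ∑ i, ⟪y, b i⟫ ^ 2 = ‖y‖ ^ 2 := b.sum_sq_inner_left
  rw [Finset.sum_sub_distrib, ← Finset.mul_sum, ← Finset.mul_sum, ← Finset.mul_sum, hsq,
    ← integral_finsetSum _ fun i _ =>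
      integrable_sphereProb (f := fun x => ⟪gradient H x, b i⟫ ^ 2) fun x hx =>
        ((h.continuousAt_gradient hx).inner continuousAt_const).pow 2,
    ← integral_finsetSum _ fun i _ =>
      integrable_sphereProb (f := fun x => H x * (⟪gradient H x, b i⟫ * ⟪x, b i⟫)) fun x hx =>
        (h.continuousAt hx).mul (((h.continuousAt_gradient hx).inner continuousAt_const).mul
          (continuousAt_id.inner continuousAt_const))] at h1
  have h2 : ∀ u : sphere (0 : E n) 1,
      ∑ i, H u * (⟪gradient H u, b i⟫ * ⟪(u : E n), b i⟫) = H u ^ 2 := fun u => by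
    simp_rw [← Finset.mul_sum, real_inner_comm (b _) (u : E n)]
    rw [b.sum_inner_mul_inner,
      inner_gradient_self h.hom h.smooth (ne_of_mem_sphere u.2 one_ne_zero), sq]
  simp_rw [h2, hsq] at h1
  exact h1

theorem gradient_eq_on_sphere (h : IsSelfSimilarSupport H) :
    ∃ a : E n, ∀ u ∈ sphere (0 : E n) 1, gradient H u = a + (H u - ⟪u, a⟫) • u := by
  set a := gradientMean H with ha
  refine ⟨a, ?_⟩
  have hD : ∀ u ∈ sphere (0 : E n) 1, ‖gradient H u - (a + (H u - ⟪u, a⟫) • u)‖ ^ 2 =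
      ((‖gradient H u‖ ^ 2 - H u ^ 2) - 2 * ⟪gradient H u, a⟫) +
        ((‖a‖ ^ 2 - ⟪u, a⟫ ^ 2) + 2 * (H u * ⟪u, a⟫)) := by
    intro u hu
    have hu1 : ⟪u, u⟫ = 1 := by simp [mem_sphere_zero_iff_norm.1 hu]
    have hX := inner_gradient_self h.hom h.smooth (ne_of_mem_sphere hu one_ne_zero)
    simp only [← real_inner_self_eq_norm_sq, inner_sub_left, inner_sub_right, inner_add_left,
      inner_add_right, real_inner_smul_left, real_inner_smul_right, hu1, hX,
      real_inner_comm (gradient H u) u, real_inner_comm (gradient H u) a, real_inner_comm u a]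
    ring
  have hc : ∀ x : E n, x ≠ 0 →
      ContinuousAt (fun x => ‖gradient H x - (a + (H x - ⟪x, a⟫) • x)‖ ^ 2) x := fun x hx =>
    (((h.continuousAt_gradient hx).sub (continuousAt_const.add (((h.continuousAt hx).sub
      (continuousAt_id.inner continuousAt_const)).smul continuousAt_id))).norm).pow 2
  have i1 : Integrable (fun u : sphere (0 : E n) 1 => ‖gradient H u‖ ^ 2) (sphereProb n) :=
    integrable_sphereProb (f := fun x => ‖gradient H x‖ ^ 2) fun x hx =>
      (h.continuousAt_gradient hx).norm.pow 2
  have i2 : Integrable (fun u : sphere (0 : E n) 1 => H u ^ 2) (sphereProb n) :=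
    integrable_sphereProb (f := fun x => H x ^ 2) fun x hx => (h.continuousAt hx).pow 2
  have i3 : Integrable (fun u : sphere (0 : E n) 1 => 2 * ⟪gradient H u, a⟫) (sphereProb n) :=
    (h.integrable_gradient.inner_const a).const_mul 2
  have i4 : Integrable (fun u : sphere (0 : E n) 1 => ⟪(u : E n), a⟫ ^ 2) (sphereProb n) :=
    integrable_sphereProb (f := fun x => ⟪x, a⟫ ^ 2) fun x _ =>
      (continuousAt_id.inner continuousAt_const).pow 2
  have i5 : Integrable (fun u : sphere (0 : E n) 1 => 2 * (H u * ⟪(u : E n), a⟫))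
      (sphereProb n) :=
    integrable_sphereProb (f := fun x => 2 * (H x * ⟪x, a⟫)) fun x hx =>
      continuousAt_const.mul ((h.continuousAt hx).mul (continuousAt_id.inner continuousAt_const))
  have i6 : Integrable (fun _ : sphere (0 : E n) 1 => ‖a‖ ^ 2) (sphereProb n) :=
    integrable_const _
  have i7 : Integrable (fun u : sphere (0 : E n) 1 => ‖gradient H u‖ ^ 2 - H u ^ 2)
      (sphereProb n) := i1.sub i2
  have i8 : Integrable (fun u : sphere (0 : E n) 1 =>
      ‖gradient H u‖ ^ 2 - H u ^ 2 - 2 * ⟪gradient H u, a⟫) (sphereProb n) := i7.sub i3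
  have i9 : Integrable (fun u : sphere (0 : E n) 1 => ‖a‖ ^ 2 - ⟪(u : E n), a⟫ ^ 2)
      (sphereProb n) := i6.sub i4
  have i10 : Integrable (fun u : sphere (0 : E n) 1 =>
      ‖a‖ ^ 2 - ⟪(u : E n), a⟫ ^ 2 + 2 * (H u * ⟪(u : E n), a⟫)) (sphereProb n) := i9.add i5
  have hzero : ∫ u : sphere (0 : E n) 1,
      ‖gradient H u - (a + (H u - ⟪(u : E n), a⟫) • (u : E n))‖ ^ 2 ∂sphereProb n ≤ 0 := by
    rw [integral_congr_ae (.of_forall fun u : sphere (0 : E n) 1 => hD u u.2),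
      integral_add i8 i10, integral_sub i7 i3, integral_sub i1 i2, integral_add i9 i5,
      integral_sub i6 i4, integral_const_mul, integral_const_mul, h.integral_inner_gradient]
    have h1 := h.integral_norm_sq_gradient_le
    have h2 := h.inner_integral_gradient a
    have h3 := sq_inner_integral_eq a
    rw [← ha, real_inner_self_eq_norm_sq] at h2
    rw [← ha] at h1 ⊢
    simp only [integral_const, probReal_univ, one_smul, real_inner_self_eq_norm_sq]
    have hn : (0 : ℝ) < n + 1 := by positivity
    refine nonpos_of_mul_nonpos_right (a := (n : ℝ) + 1) ?_ hn
    linarith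
  have hnn : 0 ≤ fun u : sphere (0 : E n) 1 =>
      ‖gradient H u - (a + (H u - ⟪(u : E n), a⟫) • (u : E n))‖ ^ 2 := fun u => sq_nonneg _
  have hae := (integral_eq_zero_iff_of_nonneg hnn (integrable_sphereProb hc)).1
    (hzero.antisymm (integral_nonneg hnn))
  have hcont : Continuous fun u : sphere (0 : E n) 1 =>
      ‖gradient H u - (a + (H u - ⟪(u : E n), a⟫) • (u : E n))‖ ^ 2 :=
    continuous_iff_continuousAt.2 fun u : sphere (0 : E n) 1 =>
      (hc u (ne_of_mem_sphere u.2 one_ne_zero)).comp_of_eq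
        continuous_subtype_val.continuousAt rfl
  have heq := (hcont.ae_eq_iff_eq (sphereProb n) continuous_const).1 hae
  intro u hu
  have h1 : ‖gradient H u - (a + (H u - ⟪u, a⟫) • u)‖ ^ 2 = 0 := congrFun heq ⟨u, hu⟩
  simpa [sub_eq_zero] using h1

end IsSelfSimilarSupport

end Rigidity

section RoundSphere

variable {n : ℕ} {H : E n → ℝ}

namespace IsSelfSimilarSupport

theorem eq_one_of_dim_one {H : E 0 → ℝ} (h : IsSelfSimilarSupport H) {x : E 0}
    (hx : x ∈ sphere (0 : E 0) 1) : H x = 1 := by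
  have hx0 := ne_of_mem_sphere hx one_ne_zero
  have hid : ((hess H x + proj x : E 0 →L[ℝ] E 0) : E 0 →ₗ[ℝ] E 0) = LinearMap.id := by
    ext1 v
    obtain ⟨t, rfl⟩ := exists_smul_eq_of_finrank_eq_one (K := ℝ) (by simp) hx0 v
    simp [proj, hess_apply_self h.hom h.smooth hx0, mem_sphere_zero_iff_norm.1 hx]
  rw [← h.flow x hx, sigmaDet]
  change (LinearMap.det ((hess H x + proj x : E 0 →L[ℝ] E 0) : E 0 →ₗ[ℝ] E 0))⁻¹ = 1
  rw [hid]
  simp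

theorem gradient_eq (h : IsSelfSimilarSupport H) :
    ∃ a : E n, ∀ x, x ≠ 0 → gradient H x = a + ((H x - ⟪x, a⟫) * (‖x‖ ^ 2)⁻¹) • x := by
  obtain ⟨a, ha⟩ := h.gradient_eq_on_sphere
  refine ⟨a, fun x hx => ?_⟩
  have hn := inv_pos.2 (norm_pos_iff.2 hx)
  have h1 := ha _ (inv_norm_smul_mem_sphere hx)
  rw [gradient_smul_of_pos h.hom h.smooth hn hx, h.hom _ _ hn, real_inner_smul_left] at h1
  rw [h1, smul_smul]
  congr 2
  ring

theorem exists_eq_norm_add_inner (h : IsSelfSimilarSupport H) (hn : n ≠ 0) :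
    ∃ (c : ℝ) (a : E n), ∀ x, x ≠ 0 → H x = c * ‖x‖ + ⟪x, a⟫ := by
  obtain ⟨a, ha⟩ := h.gradient_eq
  have hconn : IsPreconnected ({0}ᶜ : Set (E n)) :=
    (isConnected_compl_singleton_of_one_lt_rank
      (by
        rw [← Module.finrank_eq_rank, finrank_euclideanSpace_fin]
        exact_mod_cast Nat.succ_lt_succ (Nat.pos_of_ne_zero hn)) 0).isPreconnected
  have hd : ∀ x ∈ ({0}ᶜ : Set (E n)),
      HasFDerivAt (fun x => (H x - ⟪x, a⟫) * ‖x‖⁻¹) (0 : E n →L[ℝ] ℝ) x := by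
    intro x hx
    have hx0 : ‖x‖ ≠ 0 := norm_ne_zero_iff.2 hx
    have h1 := (hasGradientAt_of_contDiffOn h.smooth hx).hasFDerivAt
    have h2 : HasFDerivAt (fun x : E n => ⟪x, a⟫) (innerSL ℝ a) x := by
      simp_rw [real_inner_comm a]
      exact (innerSL ℝ a).hasFDerivAt
    have h3 := (hasDerivAt_inv hx0).comp_hasFDerivAt x (hasFDerivAt_norm' hx)
    refine ((h1.fun_sub h2).fun_mul h3).congr_fderiv ?_
    ext v
    have h4 : ⟪gradient H x, v⟫ = ⟪a, v⟫ + ((H x - ⟪x, a⟫) * (‖x‖ ^ 2)⁻¹) * ⟪x, v⟫ := by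
      rw [ha x hx, inner_add_left, real_inner_smul_left]
    change (H x - ⟪x, a⟫) * (-(‖x‖ ^ 2)⁻¹ * (‖x‖⁻¹ * ⟪x, v⟫)) +
      ‖x‖⁻¹ * (⟪gradient H x, v⟫ - ⟪a, v⟫) = 0
    rw [h4]
    ring
  obtain ⟨c, hc⟩ := isOpen_compl_singleton.exists_is_const_of_fderiv_eq_zero hconn
    (fun x hx => (hd x hx).differentiableAt.differentiableWithinAt) fun x hx => (hd x hx).fderiv
  refine ⟨c, a, fun x hx => ?_⟩
  rw [← hc x hx, inv_mul_cancel_right₀ (norm_ne_zero_iff.2 hx), sub_add_cancel]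

end IsSelfSimilarSupport

theorem hess_eq_of_eq_norm_add_inner {c : ℝ} {a : E n}
    (hH : ∀ x, x ≠ 0 → H x = c * ‖x‖ + ⟪x, a⟫) {x : E n} (hx : x ∈ sphere (0 : E n) 1) :
    hess H x = c • (ContinuousLinearMap.id ℝ (E n) - proj x) := by
  have hgrad : ∀ y : E n, y ≠ 0 → gradient H y = (c * ‖y‖⁻¹) • y + a := by
    intro y hy
    refine HasGradientAt.gradient ?_
    have h2 : HasFDerivAt (fun x : E n => ⟪x, a⟫) (innerSL ℝ a) y := by
      simp_rw [real_inner_comm a]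
      exact (innerSL ℝ a).hasFDerivAt
    have h1 := ((hasFDerivAt_norm' hy).const_mul c).fun_add h2
    rw [hasGradientAt_iff_hasFDerivAt]
    refine (h1.congr_of_eventuallyEq ?_).congr_fderiv ?_
    · filter_upwards [isOpen_compl_singleton.mem_nhds hy] with z hz using hH z hz
    · ext v
      simp [mul_assoc]
  have hx0 := ne_of_mem_sphere hx one_ne_zero
  have hx1 := mem_sphere_zero_iff_norm.1 hx
  have h3 := (((hasDerivAt_inv (norm_ne_zero_iff.2 hx0)).comp_hasFDerivAt x
    (hasFDerivAt_norm' hx0)).const_mul c).fun_smul (hasFDerivAt_id x) |>.add_const a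
  have h4 : gradient H =ᶠ[nhds x] fun y => (c * ‖y‖⁻¹) • y + a := by
    filter_upwards [isOpen_compl_singleton.mem_nhds hx0] with z hz using hgrad z hz
  rw [hess, (h3.congr_of_eventuallyEq h4).fderiv]
  ext1 v
  simp [hx1, proj]
  module

theorem sigmaDet_eq_pow {c : ℝ} (hc : c ≠ 0) {x : E n} (hx : x ∈ sphere (0 : E n) 1)
    (hhess : hess H x = c • (ContinuousLinearMap.id ℝ (E n) - proj x)) : sigmaDet H x = c ^ n := by
  have hx1 := mem_sphere_zero_iff_norm.1 hx
  have h1 : ((hess H x + proj x : E n →L[ℝ] E n) : E n →ₗ[ℝ] E n) =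
      c • LinearMap.transvection ((innerSL ℝ x : E n →L[ℝ] ℝ) : E n →ₗ[ℝ] ℝ) ((c⁻¹ - 1) • x) := by
    rw [hhess]
    ext1 v
    simp [LinearMap.transvection.apply, proj]
    match_scalars <;> field_simp
    ring
  change LinearMap.det ((hess H x + proj x : E n →L[ℝ] E n) : E n →ₗ[ℝ] E n) = _
  rw [h1, LinearMap.det_smul, LinearMap.transvection.det, finrank_euclideanSpace_fin]
  simp [hx1]
  field_simp
  ring

theorem IsSelfSimilarSupport.eq_one (h : IsSelfSimilarSupport H) {x : E n}
    (hx : x ∈ sphere (0 : E n) 1) : H x = 1 := by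
  rcases eq_or_ne n 0 with rfl | hn
  · exact h.eq_one_of_dim_one hx
  obtain ⟨c, a, hH⟩ := h.exists_eq_norm_add_inner hn
  have hx' : -x ∈ sphere (0 : E n) 1 := by simpa using hx
  have hsum : H x + H (-x) = 2 * c := by
    rw [hH x (ne_of_mem_sphere hx one_ne_zero), hH _ (ne_of_mem_sphere hx' one_ne_zero), norm_neg,
      mem_sphere_zero_iff_norm.1 hx, inner_neg_left]
    ring
  have hc : 0 < c := by linarith [h.pos x hx, h.pos _ hx']
  have hval : ∀ y ∈ sphere (0 : E n) 1, H y = (c ^ n)⁻¹ := fun y hy => by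
    rw [← h.flow y hy, sigmaDet_eq_pow hc.ne' hy (hess_eq_of_eq_norm_add_inner hH hy)]
  have hcn : c = (c ^ n)⁻¹ := by
    rw [hval x hx, hval _ hx'] at hsum
    linarith
  have h1 : c ^ (n + 1) = 1 := by
    rw [pow_succ']
    nth_rw 1 [hcn]
    exact inv_mul_cancel₀ (pow_pos hc n).ne'
  rw [hval x hx, ← hcn]
  exact (pow_eq_one_iff_of_nonneg hc.le n.succ_ne_zero).1 h1

theorem body_eq_closedBall (hH : ∀ x ∈ sphere (0 : E n) 1, H x = 1) :
    body H = closedBall (0 : E n) 1 := by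
  ext y
  rw [mem_closedBall_zero_iff]
  refine ⟨fun hy => ?_, fun hy x hx => ?_⟩
  · rcases eq_or_ne y 0 with rfl | hy0
    · simp
    · have h1 := hy _ (inv_norm_smul_mem_sphere hy0)
      rwa [hH _ (inv_norm_smul_mem_sphere hy0), real_inner_smul_right, real_inner_self_eq_norm_sq,
        sq, inv_mul_cancel_left₀ (norm_ne_zero_iff.2 hy0)] at h1
  · rw [hH x hx]
    calc ⟪y, x⟫ ≤ ‖y‖ * ‖x‖ := real_inner_le_norm y x
      _ ≤ 1 := by rwa [mem_sphere_zero_iff_norm.1 hx, mul_one]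

end RoundSphere

/-- Uniqueness of closed self-similar solutions of the Gauss curvature flow
(Gage; Andrews; Choi–Daskalopoulos): if `𝒦 = h`, i.e. `(σ_n)⁻¹ = h` on `S^n`,
then the body is the origin-centred closed unit ball. -/
theorem stmt12 (n : ℕ) (H : E n → ℝ)
    (hhom : ∀ (t : ℝ) (x : E n), 0 < t → H (t • x) = t * H x)
    (hsmooth : ContDiffOn ℝ (⊤ : ℕ∞) H {(0 : E n)}ᶜ)
    (hpos : ∀ x ∈ sphere (0 : E n) 1, 0 < H x)
    (hconvex : ∀ x ∈ sphere (0 : E n) 1, ∀ v : E n, ⟪v, x⟫ = 0 → v ≠ 0 →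
      0 < ⟪(hess H x) v, v⟫)
    (hflow : ∀ x ∈ sphere (0 : E n) 1, (sigmaDet H x)⁻¹ = H x) :
    body H = Metric.closedBall (0 : E n) 1 := by
  exact body_eq_closedBall fun _ hx => IsSelfSimilarSupport.eq_one
    ⟨hhom, hsmooth, hpos, hconvex, hflow⟩ hx

end
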